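/- arXiv:math/0412020 — 4 statements merged into one kernel-verified Lean document; each statement's English description precedes it below -/
import Mathlib

section
/- Let $(F_i, F_i')$, $i=1,\dots,n$, be the $n$ pairs of opposite faces of the unit cube $C^n=[0,1]^n$. If $B_1,\dots,B_n$ are closed subsets of $C^n$ such that each $B_i$ separates $F_i$ from $F_i'$ in $C^n$ (i.e. $C^n\setminus B_i$ is a disjoint union of two relatively open sets $U_i, U_i'$ with $F_i\subset U_i$ and $F_i'\subset U_i'$), then $\bigcap_{i=1}^n B_i$ is nonempty. -/
open Metric Set

namespace CubicalCochain

variable {ι : Type*} [DecidableEq ι]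

/-- The `0`-`1` vector supported on `S`. -/
def corner (S : Finset ι) : ι → ℕ := fun i => if i ∈ S then 1 else 0

lemma corner_apply_of_notMem {S : Finset ι} {i : ι} (h : i ∉ S) : corner S i = 0 := if_neg h

lemma corner_le_one (S : Finset ι) (i : ι) : corner S i ≤ 1 := by
  unfold corner; split_ifs <;> simp

lemma add_single_add_corner_erase {S : Finset ι} {j : ι} (h : j ∈ S) (x : ι → ℕ) :
    x + Pi.single j 1 + corner (S.erase j) = x + corner S := by
  ext i
  by_cases hij : i = j
  · subst hij; simp [corner, h]
  · simp [corner, hij]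

/-- The value on the cube with lowest vertex `x` and edge directions `J` of the mod 2 cup product
`δ(l 0) ∪ ⋯ ∪ δ(l (m - 1))` of the coboundaries of the vertex functions `l i`. -/
def cupCoboundary (l : ℕ → (ι → ℕ) → ZMod 2) : ℕ → Finset ι → (ι → ℕ) → ZMod 2
  | 0, _, _ => 1
  | m + 1, J, x => ∑ j ∈ J, cupCoboundary l m (J.erase j) x *
      (l m (x + corner J) + l m (x + corner (J.erase j)))

lemma sum_sum_erase_comm {M : Type*} [AddCommMonoid M] (J : Finset ι) (f : ι → ι → M) :
    ∑ j ∈ J, ∑ k ∈ J.erase j, f j k = ∑ k ∈ J, ∑ j ∈ J.erase k, f j k := by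
  refine Finset.sum_comm' fun j k => ?_
  simp only [Finset.mem_erase]
  tauto

lemma sum_sum_erase_eq_zero (J : Finset ι) (f : ι → ι → ZMod 2) (hf : ∀ j k, f j k = f k j) :
    ∑ j ∈ J, ∑ k ∈ J.erase j, f j k = 0 := by
  rw [Finset.sum_sigma']
  refine Finset.sum_involution (fun p _ => ⟨p.2, p.1⟩) ?_ ?_ ?_ ?_
  · rintro ⟨j, k⟩ _
    simp only [hf k j]
    exact CharTwo.add_self_eq_zero _
  · rintro ⟨j, k⟩ h _ heq
    simp only [Finset.mem_sigma, Finset.mem_erase] at h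
    simp only [Sigma.mk.injEq] at heq
    exact h.2.1 heq.1
  · rintro ⟨j, k⟩ h
    simp only [Finset.mem_sigma, Finset.mem_erase] at h ⊢
    exact ⟨h.2.2, fun e => h.2.1 e.symm, h.1⟩
  · rintro ⟨j, k⟩ _
    rfl

/-- A cup product of coboundaries is a cocycle. -/
lemma sum_cupCoboundary_add_single (l : ℕ → (ι → ℕ) → ZMod 2) (m : ℕ) (J : Finset ι)
    (x : ι → ℕ) :
    ∑ j ∈ J, cupCoboundary l m (J.erase j) (x + Pi.single j 1) =
      ∑ j ∈ J, cupCoboundary l m (J.erase j) x := by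
  induction m generalizing J with
  | zero => rfl
  | succ m ih =>
    have upper : ∑ j ∈ J, cupCoboundary l (m + 1) (J.erase j) (x + Pi.single j 1) =
        ∑ k ∈ J, ∑ j ∈ J.erase k, cupCoboundary l m ((J.erase k).erase j) x *
          (l m (x + corner J) + l m (x + corner (J.erase k))) := by
      simp only [cupCoboundary]
      rw [sum_sum_erase_comm]
      refine Finset.sum_congr rfl fun k hk => ?_
      rw [← Finset.sum_mul, ← ih, Finset.sum_mul]
      refine Finset.sum_congr rfl fun j hj => ?_
      have hjJ := Finset.mem_of_mem_erase hj
      rw [Finset.erase_right_comm, add_single_add_corner_erase hjJ,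
        add_single_add_corner_erase hj]
    have lower : ∑ j ∈ J, cupCoboundary l (m + 1) (J.erase j) x =
        ∑ k ∈ J, ∑ j ∈ J.erase k, cupCoboundary l m ((J.erase k).erase j) x *
          l m (x + corner (J.erase k)) := by
      simp only [cupCoboundary, mul_add, Finset.sum_add_distrib]
      rw [add_eq_left]
      refine sum_sum_erase_eq_zero J (fun j k => cupCoboundary l m ((J.erase j).erase k) x *
          l m (x + corner ((J.erase j).erase k))) fun j k => ?_
      rw [Finset.erase_right_comm]
    rw [upper, lower]
    simp only [mul_add, Finset.sum_add_distrib]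
    rw [add_eq_right]
    refine sum_sum_erase_eq_zero J (fun j k => cupCoboundary l m ((J.erase j).erase k) x *
          l m (x + corner J)) fun j k => ?_
    rw [Finset.erase_right_comm]

/-- `δ(l 0) ∪ ⋯ ∪ δ(l m)` is the coboundary of `δ(l 0) ∪ ⋯ ∪ δ(l (m - 1)) ∪ l m`. -/
lemma cupCoboundary_succ_eq_sum (l : ℕ → (ι → ℕ) → ZMod 2) (m : ℕ) (J : Finset ι) (x : ι → ℕ) :
    cupCoboundary l (m + 1) J x = ∑ j ∈ J,
      (cupCoboundary l m (J.erase j) (x + Pi.single j 1) *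
          l m (x + Pi.single j 1 + corner (J.erase j)) +
        cupCoboundary l m (J.erase j) x * l m (x + corner (J.erase j))) := by
  simp only [cupCoboundary, mul_add, Finset.sum_add_distrib]
  congr 1
  rw [← Finset.sum_mul, ← sum_cupCoboundary_add_single, Finset.sum_mul]
  refine Finset.sum_congr rfl fun j hj => ?_
  rw [add_single_add_corner_erase hj]

lemma cupCoboundary_eq_zero (l : ℕ → (ι → ℕ) → ZMod 2) {i m : ℕ} (him : i < m) (J : Finset ι)
    (x : ι → ℕ) (c : ZMod 2) (h : ∀ S ⊆ J, l i (x + corner S) = c) :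
    cupCoboundary l m J x = 0 := by
  induction m generalizing J with
  | zero => omega
  | succ m ih =>
    refine Finset.sum_eq_zero fun j _ => ?_
    rcases (Nat.lt_succ_iff_lt_or_eq.mp him) with him | rfl
    · rw [ih him _ fun S hS => h S (hS.trans (Finset.erase_subset _ _)), zero_mul]
    · rw [h J subset_rfl, h _ (Finset.erase_subset _ _), CharTwo.add_self_eq_zero, mul_zero]

variable [Fintype ι]

lemma sum_piFinset_eq_sum_update (s : ι → Finset ℕ) (j : ι) (a : ℕ) (f : (ι → ℕ) → ZMod 2) :
    ∑ x ∈ Fintype.piFinset s, f x =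
      ∑ x ∈ Fintype.piFinset (Function.update s j {a}), ∑ b ∈ s j, f (Function.update x j b) := by
  rw [Finset.sum_sigma']
  refine Finset.sum_bij' (fun x _ => ⟨Function.update x j a, x j⟩)
    (fun p _ => Function.update p.1 j p.2) ?_ ?_ ?_ ?_ ?_
  · intro x hx
    simp only [Fintype.mem_piFinset, Finset.mem_sigma] at hx ⊢
    refine ⟨fun i => ?_, hx j⟩
    by_cases hij : i = j
    · subst hij; simp
    · simp [hij, hx i]
  · rintro ⟨x, b⟩ hx
    simp only [Fintype.mem_piFinset, Finset.mem_sigma] at hx ⊢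
    intro i
    by_cases hij : i = j
    · subst hij; simpa using hx.2
    · simpa [hij] using hx.1 i
  · intro x _
    simp
  · rintro ⟨x, b⟩ hx
    simp only [Fintype.mem_piFinset, Finset.mem_sigma] at hx
    have : x j = a := by simpa using hx.1 j
    simp [← this]
  · intro x _
    simp

lemma sum_piFinset_update_singleton (s : ι → Finset ℕ) (j : ι) (a b : ℕ)
    (f : (ι → ℕ) → ZMod 2) :
    ∑ x ∈ Fintype.piFinset (Function.update s j {a}), f x =
      ∑ x ∈ Fintype.piFinset (Function.update s j {b}), f (Function.update x j a) := by
  rw [sum_piFinset_eq_sum_update _ j b]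
  simp

lemma sum_piFinset_add_single (s : ι → Finset ℕ) (j : ι) (k : ℕ) (hs : s j = Finset.range k)
    (f : (ι → ℕ) → ZMod 2) :
    ∑ x ∈ Fintype.piFinset s, (f (x + Pi.single j 1) + f x) =
      ∑ x ∈ Fintype.piFinset (Function.update s j {k}), f x +
        ∑ x ∈ Fintype.piFinset (Function.update s j {0}), f x := by
  rw [sum_piFinset_eq_sum_update s j 0, sum_piFinset_update_singleton s j k 0,
    sum_piFinset_update_singleton s j 0 0 f, ← Finset.sum_add_distrib, hs]
  refine Finset.sum_congr rfl fun x _ => ?_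
  have hupd (b : ℕ) : Function.update x j b + Pi.single j 1 = Function.update x j (b + 1) := by
    ext i
    by_cases hij : i = j
    · subst hij; simp
    · simp [hij]
  simp only [hupd]
  have := Finset.sum_range_sub (fun b => f (Function.update x j b)) k
  simpa only [CharTwo.sub_eq_add] using this

end CubicalCochain

open CubicalCochain in
lemma sum_cupCoboundary_eq_one {n k : ℕ} (l : ℕ → (Fin n → ℕ) → ZMod 2)
    (h0 : ∀ (i : Fin n) x, x i = 0 → l i x = 0) (h1 : ∀ (i : Fin n) x, x i = k → l i x = 1)
    (m : ℕ) (hm : m ≤ n) :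
    ∑ x ∈ Fintype.piFinset (fun i : Fin n => if i.val < m then Finset.range k else {k}),
      cupCoboundary l m (Finset.univ.filter fun i : Fin n => i.val < m) x = 1 := by
  induction m with
  | zero => simp [cupCoboundary]
  | succ m ih =>
    set s : Fin n → Finset ℕ := fun i => if i.val < m + 1 then Finset.range k else {k} with hs
    set J : Finset (Fin n) := Finset.univ.filter fun i => i.val < m + 1 with hJ
    let p : Fin n := ⟨m, hm⟩
    have hpJ : p ∈ J := by simp [hJ, p]
    have hJp : J.erase p = Finset.univ.filter fun i : Fin n => i.val < m := by
      ext i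
      simp only [hJ, p, Finset.mem_erase, Finset.mem_filter, Finset.mem_univ, true_and, ne_eq,
        Fin.ext_iff]
      omega
    have hsp : Function.update s p {k} = fun i => if i.val < m then Finset.range k else {k} := by
      ext1 i
      by_cases hi : i = p
      · subst hi; simp [p]
      · have : i.val ≠ m := fun e => hi (Fin.ext e)
        simp only [hs, Function.update_of_ne hi]
        congr 1
        simp only [eq_iff_iff]
        omega
    have face {j : Fin n} {a : ℕ} {x : Fin n → ℕ}
        (hx : x ∈ Fintype.piFinset (Function.update s j {a})) (S : Finset (Fin n))
        (hS : S ⊆ J.erase j) : (x + corner S) j = a := by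
      have hxj := Fintype.mem_piFinset.mp hx j
      rw [Function.update_self, Finset.mem_singleton] at hxj
      rw [Pi.add_apply, hxj, corner_apply_of_notMem fun h => Finset.notMem_erase j J (hS h),
        add_zero]
    simp only [cupCoboundary_succ_eq_sum]
    rw [Finset.sum_comm, Finset.sum_eq_single_of_mem p hpJ]
    · rw [sum_piFinset_add_single s p k (by simp [hs, p]) (fun x =>
        cupCoboundary l m (J.erase p) x * l m (x + corner (J.erase p)))]
      rw [Finset.sum_eq_zero (s := Fintype.piFinset (Function.update s p {0})), add_zero,
        ← ih (by omega), ← hsp, ← hJp]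
      · refine Finset.sum_congr rfl fun x hx => ?_
        rw [h1 p _ (face hx _ subset_rfl), mul_one]
      · intro x hx
        rw [h0 p _ (face hx _ subset_rfl), mul_zero]
    · intro j hj hjp
      have hjm : j.val < m + 1 := by simpa [hJ] using hj
      have hjm' : j.val < m := lt_of_le_of_ne (Nat.lt_succ_iff.mp hjm) fun e => hjp (Fin.ext e)
      rw [sum_piFinset_add_single s j k (if_pos hjm) (fun x =>
        cupCoboundary l m (J.erase j) x * l m (x + corner (J.erase j)))]
      rw [Finset.sum_eq_zero, Finset.sum_eq_zero, add_zero]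
      · intro x hx
        rw [cupCoboundary_eq_zero l hjm' _ x 0 fun S hS => h0 j _ (face hx S hS), zero_mul]
      · intro x hx
        rw [cupCoboundary_eq_zero l hjm' _ x 1 fun S hS => h1 j _ (face hx S hS), zero_mul]

open CubicalCochain in
/-- **Kuhn's combinatorial lemma**: in a grid whose vertices carry `n` binary labels, the `i`-th
being `0` on the lower and `1` on the upper `i`-th face, some unit cell sees both values of each
label. -/
lemma exists_cell_forall_label {n k : ℕ} (l : Fin n → (Fin n → ℕ) → ZMod 2)
    (h0 : ∀ i x, x i = 0 → l i x = 0) (h1 : ∀ i x, x i = k → l i x = 1) :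
    ∃ x : Fin n → ℕ, (∀ i, x i < k) ∧
      ∀ i c, ∃ e : Fin n → ℕ, (∀ j, e j ≤ 1) ∧ l i (x + e) = c := by
  let l' : ℕ → (Fin n → ℕ) → ZMod 2 := fun m x => if h : m < n then l ⟨m, h⟩ x else 0
  have hl' (i : Fin n) : l' i = l i := by ext1 x; simp [l']
  have hsum := sum_cupCoboundary_eq_one (k := k) l' (fun i x h => by rw [hl', h0 i x h])
    (fun i x h => by rw [hl', h1 i x h]) n le_rfl
  obtain ⟨x, hx, hne⟩ := Finset.exists_ne_zero_of_sum_ne_zero (hsum.trans_ne one_ne_zero)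
  refine ⟨x, fun i => by simpa using Fintype.mem_piFinset.mp hx i, fun i c => ?_⟩
  by_contra! hc
  refine hne (cupCoboundary_eq_zero l' i.isLt _ x (c + 1) fun S _ => ?_)
  have hS := hc (corner S) (corner_le_one S)
  rw [hl']
  have hflip : ∀ a b : ZMod 2, a ≠ b → a = b + 1 := by decide
  exact hflip _ _ hS

/-- The closed-cover form of the **Poincaré–Miranda theorem**. -/
theorem exists_mem_Icc_forall_mem_inter {n : ℕ} (A A' : Fin n → Set (Fin n → ℝ))
    (hA : ∀ i, IsClosed (A i)) (hA' : ∀ i, IsClosed (A' i))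
    (hcover : ∀ i, Icc 0 1 ⊆ A i ∪ A' i)
    (h0 : ∀ i, ∀ x ∈ Icc (0 : Fin n → ℝ) 1, x i = 0 → x ∈ A i)
    (h1 : ∀ i, ∀ x ∈ Icc (0 : Fin n → ℝ) 1, x i = 1 → x ∈ A' i) :
    ∃ x ∈ Icc (0 : Fin n → ℝ) 1, ∀ i, x ∈ A i ∩ A' i := by
  classical
  let pt (N : ℕ) (x : Fin n → ℕ) : Fin n → ℝ := fun i => (x i : ℝ) / (N + 1)
  have hpt {N : ℕ} {x : Fin n → ℕ} (hx : ∀ i, x i ≤ N + 1) : pt N x ∈ Icc (0 : Fin n → ℝ) 1 := by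
    refine ⟨fun i => by simp only [pt, Pi.zero_apply]; positivity, fun i => ?_⟩
    simp only [pt, Pi.one_apply]
    rw [div_le_one (by positivity)]
    exact_mod_cast hx i
  have cell (N : ℕ) : ∃ x : Fin n → ℕ, (∀ i, x i < N + 1) ∧
      ∀ i, (∃ e : Fin n → ℕ, (∀ j, e j ≤ 1) ∧ pt N (x + e) ∈ A i) ∧
        ∃ e : Fin n → ℕ, (∀ j, e j ≤ 1) ∧ pt N (x + e) ∈ A' i := by
    let l : Fin n → (Fin n → ℕ) → ZMod 2 := fun i x =>
      if x i = 0 then 0 else if x i = N + 1 then 1 else if pt N x ∈ A i then 0 else 1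
    obtain ⟨x, hx, hl⟩ := exists_cell_forall_label (k := N + 1) l
      (fun i x h => by simp [l, h]) (fun i x h => by simp [l, h])
    have hle {e : Fin n → ℕ} (he : ∀ j, e j ≤ 1) : pt N (x + e) ∈ Icc (0 : Fin n → ℝ) 1 :=
      hpt fun i => by have := hx i; have := he i; rw [Pi.add_apply]; omega
    refine ⟨x, hx, fun i => ⟨?_, ?_⟩⟩
    · obtain ⟨e, he, hle0⟩ := hl i 0
      refine ⟨e, he, ?_⟩
      simp only [l] at hle0
      split_ifs at hle0 with hz _ hA
      · exact h0 i _ (hle he) (by simp only [pt, hz, Nat.cast_zero, zero_div])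
      · exact absurd hle0 (by decide)
      · exact hA
      · exact absurd hle0 (by decide)
    · obtain ⟨e, he, hle1⟩ := hl i 1
      refine ⟨e, he, ?_⟩
      simp only [l] at hle1
      split_ifs at hle1 with _ ho hA
      · exact absurd hle1 (by decide)
      · refine h1 i _ (hle he) ?_
        simp only [pt, ho]
        push_cast
        exact div_self (by positivity)
      · exact absurd hle1 (by decide)
      · exact (hcover i (hle he)).resolve_left hA
  choose x hx hcell using cell
  obtain ⟨y, hy, φ, hφ, hlim⟩ := (isCompact_Icc (a := (0 : Fin n → ℝ)) (b := 1)).tendsto_subseq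
    fun N => hpt fun i => (hx N i).le
  have near (e : ℕ → Fin n → ℕ) (he : ∀ N j, e N j ≤ 1) :
      Filter.Tendsto (fun N => pt (φ N) (x (φ N) + e (φ N))) Filter.atTop (nhds y) := by
    rw [tendsto_pi_nhds] at hlim ⊢
    intro j
    have hsmall : Filter.Tendsto (fun N => (e N j : ℝ) / (N + 1)) Filter.atTop (nhds 0) := by
      refine squeeze_zero (fun N => by positivity) (fun N => ?_)
        tendsto_one_div_add_atTop_nhds_zero_nat
      gcongr
      exact_mod_cast he N j
    have := (hlim j).add (hsmall.comp hφ.tendsto_atTop)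
    rw [add_zero] at this
    refine this.congr fun N => ?_
    simp only [pt, Function.comp_apply, Pi.add_apply, Nat.cast_add, add_div]
  refine ⟨y, hy, fun i => ⟨?_, ?_⟩⟩
  · choose e he hmem using fun N => (hcell N i).1
    exact (hA i).mem_of_tendsto (near e he) (Filter.Eventually.of_forall fun N => hmem (φ N))
  · choose e he hmem using fun N => (hcell N i).2
    exact (hA' i).mem_of_tendsto (near e he) (Filter.Eventually.of_forall fun N => hmem (φ N))

/-- Lemma (equivalent to Brouwer): if closed sets `B i` each separate the
`i`-th pair of opposite faces of the unit cube, their intersection is nonempty. -/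
theorem cube_separating_sets_inter_nonempty (n : ℕ)
    (C : Set (EuclideanSpace ℝ (Fin n)))
    (hC : C = {x | ∀ i, x i ∈ Set.Icc (0:ℝ) 1})
    (F F' : Fin n → Set (EuclideanSpace ℝ (Fin n)))
    (hF : ∀ i, F i = {x ∈ C | x i = 0})
    (hF' : ∀ i, F' i = {x ∈ C | x i = 1})
    (B : Fin n → Set (EuclideanSpace ℝ (Fin n)))
    (hBsub : ∀ i, B i ⊆ C)
    (hBclosed : ∀ i, IsClosed (B i))
    (hsep : ∀ i, ∃ U U' : Set (EuclideanSpace ℝ (Fin n)),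
      (∃ V, IsOpen V ∧ U = V ∩ C) ∧ (∃ V', IsOpen V' ∧ U' = V' ∩ C) ∧
      C \ B i = U ∪ U' ∧ Disjoint U U' ∧ F i ⊆ U ∧ F' i ⊆ U') :
    (⋂ i, B i).Nonempty := by
  choose U U' hU hU' hunion hdisj hFU hFU' using hsep
  choose V hV hUV using hU
  choose V' hV' hUV' using hU'
  have hmemC {x : Fin n → ℝ} (hx : x ∈ Icc (0 : Fin n → ℝ) 1) : WithLp.toLp 2 x ∈ C := by
    rw [hC]
    exact fun i => ⟨hx.1 i, hx.2 i⟩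
  have hnot {i : Fin n} {x : EuclideanSpace ℝ (Fin n)} (hx : x ∈ C) (h : x ∈ V i) : x ∉ V' i := by
    have hd := hdisj i
    rw [hUV i, hUV' i] at hd
    exact fun h' => disjoint_left.mp hd ⟨h, hx⟩ ⟨h', hx⟩
  have hcont := PiLp.continuous_toLp 2 fun _ : Fin n => ℝ
  obtain ⟨x, hx, hxA⟩ := exists_mem_Icc_forall_mem_inter
    (fun i => WithLp.toLp 2 ⁻¹' (V' i)ᶜ) (fun i => WithLp.toLp 2 ⁻¹' (V i)ᶜ)
    (fun i => (hV' i).isClosed_compl.preimage hcont)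
    (fun i => (hV i).isClosed_compl.preimage hcont)
    (fun i x hx => by
      by_cases h : WithLp.toLp 2 x ∈ V i
      · exact Or.inl (hnot (hmemC hx) h)
      · exact Or.inr h)
    (fun i x hx hxi => by
      have h : WithLp.toLp 2 x ∈ U i := hFU i (hF i ▸ ⟨hmemC hx, hxi⟩)
      rw [hUV i] at h
      exact hnot (hmemC hx) h.1)
    (fun i x hx hxi h => by
      have h' : WithLp.toLp 2 x ∈ U' i := hFU' i (hF' i ▸ ⟨hmemC hx, hxi⟩)
      rw [hUV' i] at h'
      exact hnot (hmemC hx) h h'.1)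
  refine ⟨WithLp.toLp 2 x, mem_iInter.mpr fun i => ?_⟩
  by_contra hB
  have h : WithLp.toLp 2 x ∈ U i ∪ U' i := hunion i ▸ ⟨hmemC hx, hB⟩
  rw [hUV i, hUV' i] at h
  exact h.elim (fun h => (hxA i).2 h.1) fun h => (hxA i).1 h.1
end

section
/- The unit $n$-cube $[0,1]^n$ admits no finite decomposition into closed pieces of diameter strictly less than $1$ such that at most $n$ pieces meet at any point. That is, if $[0,1]^n=\bigcup_{j=1}^m A_j$ with each $A_j$ closed of diameter $<1$, then there is a point lying in at least $n+1$ of the sets $A_j$. -/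
open Metric Set

namespace KuhnCube

/-- The `j`-th vertex of the Kuhn simplex with base `v` in which coordinate `a` is
incremented at step `π a`. -/
def vertex {n : ℕ} (v : Fin n → ℕ) (π : Equiv.Perm (Fin n)) (j : ℕ) : Fin n → ℕ :=
  fun a => v a + if (π a : ℕ) < j then 1 else 0

/-- The mod 2 incidence matrix between the positions of a sequence of labels and the labels
`0, …, n`. -/
def labelMatrix {n : ℕ} (f : Fin n → ℕ) : Matrix (Fin n) (Fin n) (ZMod 2) :=
  Matrix.of fun j l => if f j = l then 1 else 0

/-- The mod 2 incidence matrix between the positions of a sequence of labels and the labels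
`1, …, n`. -/
def labelMatrixSucc {n : ℕ} (f : Fin n → ℕ) : Matrix (Fin n) (Fin n) (ZMod 2) :=
  Matrix.of fun j l => if f j = l + 1 then 1 else 0

theorem exists_label_of_det_ne_zero {n : ℕ} {f : Fin n → ℕ} (h : (labelMatrix f).det ≠ 0)
    (l : Fin n) : ∃ j, f j = l := by
  by_contra! hl
  exact h (Matrix.det_eq_zero_of_column_eq_zero l fun j => by simp [labelMatrix, hl j])

theorem det_labelMatrixSucc_eq_zero {n : ℕ} {f : Fin n → ℕ} (l : Fin n)
    (h : ∀ j, f j ≠ l + 1) : (labelMatrixSucc f).det = 0 :=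
  Matrix.det_eq_zero_of_column_eq_zero l fun j => by simp [labelMatrixSucc, h j]

/-- Modulo 2, a sequence is fully labelled iff it has an odd number of facets labelled
`1, …, n`. -/
theorem det_labelMatrix_eq_sum {n : ℕ} (f : Fin (n + 1) → ℕ) (hf : ∀ j, f j ≤ n) :
    (labelMatrix f).det = ∑ k : Fin (n + 1), (labelMatrixSucc fun j => f (k.succAbove j)).det := by
  have hcol : ∀ j, ∑ l, labelMatrix f j l = 1 := by
    intro j
    rw [Finset.sum_eq_single (⟨f j, Nat.lt_succ_of_le (hf j)⟩ : Fin (n + 1))]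
    · simp [labelMatrix]
    · intro l _ hl
      have : f j ≠ l := fun h => hl (Fin.ext h.symm)
      simp [labelMatrix, this]
    · simp
  have hdet : ((labelMatrix f).updateCol 0 fun j => ∑ l, labelMatrix f j l).det
      = (labelMatrix f).det := by
    have := Matrix.det_updateCol_sum (labelMatrix f) 0 (fun _ => 1)
    simpa using this
  rw [← hdet, Matrix.det_succ_column_zero]
  refine Finset.sum_congr rfl fun k _ => ?_
  have h1 : ((-1 : ZMod 2)) = 1 := by decide
  have h2 : (((labelMatrix f).updateCol 0 fun j => ∑ l, labelMatrix f j l).submatrix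
      k.succAbove Fin.succ) = labelMatrixSucc fun j => f (k.succAbove j) := by
    ext j l
    simp [labelMatrix, labelMatrixSucc]
  rw [h2, Matrix.updateCol_self, hcol, h1]
  simp

/-- The number modulo 2 of fully labelled Kuhn simplices in the grid `{0, …, N + 1}ⁿ`. -/
def fullCount (n N : ℕ) (label : (Fin n → ℕ) → ℕ) : ZMod 2 :=
  ∑ v : Fin n → Fin (N + 1), ∑ π : Equiv.Perm (Fin n),
    (labelMatrix fun j : Fin (n + 1) => label (vertex (fun a => (v a : ℕ)) π j)).det

/-- Kuhn's boundary conditions for a labelling of the grid `{0, …, N + 1}ⁿ`. -/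
structure IsKuhnLabelling (n N : ℕ) (label : (Fin n → ℕ) → ℕ) : Prop where
  le : ∀ x, (∀ a, x a ≤ N + 1) → label x ≤ n
  lt_of_eq_top : ∀ x, (∀ a, x a ≤ N + 1) → ∀ a : Fin n, x a = N + 1 → (a : ℕ) < label x
  ne_of_eq_zero : ∀ x, (∀ a, x a ≤ N + 1) → ∀ a : Fin n, x a = 0 → label x ≠ a + 1

theorem vertex_le {n N : ℕ} (v : Fin n → Fin (N + 1)) (π : Equiv.Perm (Fin n)) (j : ℕ)
    (a : Fin n) : vertex (fun a => (v a : ℕ)) π j a ≤ N + 1 := by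
  have := (v a).isLt
  simp only [vertex]
  split_ifs <;> omega

/-- The restriction of a Kuhn labelling to the top face in direction `0`. -/
theorem IsKuhnLabelling.face {n N : ℕ} {label : (Fin (n + 1) → ℕ) → ℕ}
    (h : IsKuhnLabelling (n + 1) N label) :
    IsKuhnLabelling n N fun w => label (Fin.cons (N + 1) w) - 1 := by
  have hb : ∀ w : Fin n → ℕ, (∀ a, w a ≤ N + 1) →
      ∀ a, (Fin.cons (N + 1) w : Fin (n + 1) → ℕ) a ≤ N + 1 := by
    intro w hw a
    refine Fin.cases ?_ (fun b => ?_) a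
    · simp
    · simpa using hw b
  refine ⟨fun w hw => ?_, fun w hw a ha => ?_, fun w hw a ha => ?_⟩
  · have := h.le _ (hb w hw)
    omega
  · have := h.lt_of_eq_top _ (hb w hw) a.succ (by simpa using ha)
    simp only [Fin.val_succ] at this
    omega
  · have := h.ne_of_eq_zero _ (hb w hw) a.succ (by simpa using ha)
    simp only [Fin.val_succ] at this
    omega

/-- Interior facets cancel in pairs: swapping two consecutive steps does not change the
facet that omits the vertex between them. -/
theorem sum_interior_facet {n : ℕ} (label : (Fin (n + 1) → ℕ) → ℕ) (v : Fin (n + 1) → ℕ)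
    (k : Fin n) :
    ∑ π : Equiv.Perm (Fin (n + 1)),
      (labelMatrixSucc fun j => label (vertex v π (k.castSucc.succ.succAbove j : Fin (n + 2)))).det
      = 0 := by
  have hne : k.castSucc ≠ k.succ := (Fin.castSucc_lt_succ (i := k)).ne
  refine Finset.sum_involution (fun π _ => Equiv.swap k.castSucc k.succ * π) ?_ ?_ ?_ ?_
  · intro π _
    have : ∀ j : Fin (n + 1),
        vertex v (Equiv.swap k.castSucc k.succ * π) (k.castSucc.succ.succAbove j : Fin (n + 2))
          = vertex v π (k.castSucc.succ.succAbove j : Fin (n + 2)) := by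
      intro j
      have hj : ((k.castSucc.succ.succAbove j : Fin (n + 2)) : ℕ) ≠ k + 1 := by
        have := Fin.succAbove_ne k.castSucc.succ j
        intro h
        exact this (Fin.ext (by simpa using h))
      funext a
      unfold vertex
      congr 1
      refine if_congr ?_ rfl rfl
      rw [Equiv.Perm.mul_apply]
      by_cases h1 : π a = k.castSucc
      · rw [h1, Equiv.swap_apply_left, Fin.val_succ, Fin.val_castSucc]
        omega
      by_cases h2 : π a = k.succ
      · rw [h2, Equiv.swap_apply_right, Fin.val_succ, Fin.val_castSucc]
        omega
      rw [Equiv.swap_apply_of_ne_of_ne h1 h2]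
    simp only [this]
    exact CharTwo.add_self_eq_zero _
  · intro π _ _ h
    have : Equiv.swap k.castSucc k.succ = 1 := by simpa using h
    exact hne (Equiv.swap_eq_one_iff.mp this)
  · simp
  · intro π _
    simp [← mul_assoc]

/-- Adding a step in direction `i` before the steps of `π`, where `i` comes last in `π`. -/
theorem vertex_finRotate {n : ℕ} (i : Fin (n + 1)) (t : ℕ) (w : Fin n → ℕ)
    (π : Equiv.Perm (Fin (n + 1))) (hi : π i = Fin.last n) (j : Fin (n + 1)) :
    vertex (i.insertNth t w) (finRotate (n + 1) * π) (j + 1)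
      = vertex (i.insertNth (t + 1) w : Fin (n + 1) → ℕ) π j := by
  funext a
  unfold vertex
  by_cases ha : a = i
  · subst ha
    have := j.isLt
    rw [Equiv.Perm.mul_apply, hi, finRotate_last]
    simp [Nat.not_lt.mpr (Nat.lt_succ_iff.mp this)]
  · have hπ : π a ≠ Fin.last n := fun h => ha (π.injective (h.trans hi.symm))
    rw [Equiv.Perm.mul_apply, coe_finRotate_of_ne_last hπ]
    obtain ⟨b, rfl⟩ := Fin.exists_succAbove_eq ha
    simp

theorem sum_range_add_succ (g : ℕ → ZMod 2) (N : ℕ) :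
    ∑ t ∈ Finset.range N, (g (t + 1) + g t) = g N + g 0 := by
  simpa only [CharTwo.sub_eq_add] using Finset.sum_range_sub g N

/-- The two extreme facets cancel in pairs, except on the top and bottom faces of the grid. -/
theorem sum_extreme_facets {n N : ℕ} (label : (Fin (n + 1) → ℕ) → ℕ)
    (h : IsKuhnLabelling (n + 1) N label) (i : Fin (n + 1))
    (π : Equiv.Perm (Fin (n + 1))) (hi : π i = Fin.last n) :
    ∑ v : Fin (n + 1) → Fin (N + 1),
      ((labelMatrixSucc fun j : Fin (n + 1) =>
          label (vertex (fun a => (v a : ℕ)) (finRotate (n + 1) * π) (j + 1))).det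
        + (labelMatrixSucc fun j : Fin (n + 1) => label (vertex (fun a => (v a : ℕ)) π j)).det)
      = ∑ w : Fin n → Fin (N + 1), (labelMatrixSucc fun j : Fin (n + 1) =>
          label (vertex (i.insertNth (N + 1) fun a => (w a : ℕ)) π j)).det := by
  rw [← (Fin.insertNthEquiv (fun _ => Fin (N + 1)) i).sum_comp, Fintype.sum_prod_type_right]
  refine Finset.sum_congr rfl fun w _ => ?_
  have hins : ∀ t : Fin (N + 1), (fun a => ((i.insertNth t w : Fin (n + 1) → Fin (N + 1)) a : ℕ))
      = i.insertNth (t : ℕ) fun a => (w a : ℕ) := by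
    intro t
    funext a
    by_cases ha : a = i
    · subst ha; simp
    · obtain ⟨b, rfl⟩ := Fin.exists_succAbove_eq ha
      simp
  simp only [Fin.insertNthEquiv_apply, hins, vertex_finRotate i _ _ π hi]
  have hz : (labelMatrixSucc fun j : Fin (n + 1) =>
      label (vertex (i.insertNth 0 fun a => (w a : ℕ)) π j)).det = 0 := by
    refine det_labelMatrixSucc_eq_zero i fun j => ?_
    have := hins 0
    simp only [Fin.val_zero] at this
    rw [← this]
    refine h.ne_of_eq_zero _ (vertex_le _ π j) i ?_
    have := j.isLt
    simp only [vertex, Fin.insertNth_apply_same, hi, Fin.val_last, Fin.val_zero]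
    rw [if_neg (by omega)]
  rw [Fin.sum_univ_eq_sum_range (fun t =>
      (labelMatrixSucc fun j : Fin (n + 1) =>
        label (vertex (i.insertNth (t + 1) fun a => (w a : ℕ)) π j)).det +
      (labelMatrixSucc fun j : Fin (n + 1) =>
        label (vertex (i.insertNth t fun a => (w a : ℕ)) π j)).det) (N + 1),
    sum_range_add_succ (fun t => (labelMatrixSucc fun j : Fin (n + 1) =>
        label (vertex (i.insertNth t fun a => (w a : ℕ)) π j)).det), hz, add_zero]

theorem vertex_insertNth_le {n N : ℕ} (i : Fin (n + 1)) (w : Fin n → Fin (N + 1))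
    (π : Equiv.Perm (Fin (n + 1))) (hi : π i = Fin.last n) (j : Fin (n + 1)) (a : Fin (n + 1)) :
    vertex (i.insertNth (N + 1) fun a => (w a : ℕ)) π j a ≤ N + 1 := by
  have := j.isLt
  unfold vertex
  by_cases ha : a = i
  · subst ha
    rw [hi, Fin.val_last, if_neg (by omega)]
    simp
  · obtain ⟨b, rfl⟩ := Fin.exists_succAbove_eq ha
    have := (w b).isLt
    rw [Fin.insertNth_apply_succAbove]
    split_ifs <;> omega

/-- Only the top face in direction `0` contributes facets labelled `1, …, n + 1`. -/
theorem det_top_facet_eq_zero {n N : ℕ} (label : (Fin (n + 1) → ℕ) → ℕ)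
    (h : IsKuhnLabelling (n + 1) N label) (i : Fin (n + 1)) (hi0 : i ≠ 0)
    (π : Equiv.Perm (Fin (n + 1))) (hi : π i = Fin.last n) (w : Fin n → Fin (N + 1)) :
    (labelMatrixSucc fun j : Fin (n + 1) =>
      label (vertex (i.insertNth (N + 1) fun a => (w a : ℕ)) π j)).det = 0 := by
  refine det_labelMatrixSucc_eq_zero 0 fun j => ?_
  have hj := j.isLt
  have := h.lt_of_eq_top _ (vertex_insertNth_le i w π hi j) i (by
    simp only [vertex, Fin.insertNth_apply_same, hi, Fin.val_last]
    rw [if_neg (by omega)])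
  have : (i : ℕ) ≠ 0 := fun h => hi0 (Fin.ext h)
  simp only [Fin.val_zero]
  omega

theorem det_top_facet {n N : ℕ} (label : (Fin (n + 1) → ℕ) → ℕ)
    (h : IsKuhnLabelling (n + 1) N label) (σ : Equiv.Perm (Fin n)) (w : Fin n → Fin (N + 1)) :
    (labelMatrixSucc fun j : Fin (n + 1) =>
      label (vertex ((0 : Fin (n + 1)).insertNth (N + 1) fun a => (w a : ℕ))
        ((finRotate (n + 1))⁻¹ * Equiv.Perm.decomposeFin.symm (0, σ)) j)).det
    = (labelMatrix fun j : Fin (n + 1) =>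
        label (Fin.cons (N + 1) (vertex (fun a => (w a : ℕ)) σ j)) - 1).det := by
  set π := (finRotate (n + 1))⁻¹ * Equiv.Perm.decomposeFin.symm (0, σ) with hπ
  have h0 : π 0 = Fin.last n := by
    rw [hπ, Equiv.Perm.mul_apply, Equiv.Perm.inv_eq_iff_eq, finRotate_last]
    simp
  have hs : ∀ a : Fin n, π a.succ = (σ a).castSucc := by
    intro a
    rw [hπ, Equiv.Perm.mul_apply, Equiv.Perm.inv_eq_iff_eq]
    ext
    rw [coe_finRotate_of_ne_last (Fin.castSucc_lt_last _).ne]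
    simp
  have hv : ∀ j : Fin (n + 1), vertex ((0 : Fin (n + 1)).insertNth (N + 1) fun a => (w a : ℕ)) π j
      = Fin.cons (N + 1) (vertex (fun a => (w a : ℕ)) σ j) := by
    intro j
    have := j.isLt
    funext a
    refine Fin.cases ?_ (fun b => ?_) a
    · simp only [vertex, h0, Fin.val_last, Fin.cons_zero]
      rw [if_neg (by omega)]
      simp
    · simp [vertex, hs]
  simp only [hv]
  congr 1
  ext j l
  have := h.lt_of_eq_top (Fin.cons (N + 1) (vertex (fun a => (w a : ℕ)) σ j)) (by
    rw [← hv]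
    exact vertex_insertNth_le 0 w π h0 j) 0 (by simp)
  simp only [labelMatrix, labelMatrixSucc, Matrix.of_apply]
  refine if_congr ?_ rfl rfl
  simp only [Fin.val_zero] at this
  omega

theorem fullCount_succ {n N : ℕ} (label : (Fin (n + 1) → ℕ) → ℕ)
    (h : IsKuhnLabelling (n + 1) N label) :
    fullCount (n + 1) N label = fullCount n N fun w => label (Fin.cons (N + 1) w) - 1 := by
  have hfacets : fullCount (n + 1) N label = ∑ v : Fin (n + 1) → Fin (N + 1),
      ∑ π : Equiv.Perm (Fin (n + 1)), ((labelMatrixSucc fun j : Fin (n + 1) =>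
          label (vertex (fun a => (v a : ℕ)) (finRotate (n + 1) * π) (j + 1))).det
        + (labelMatrixSucc fun j : Fin (n + 1) =>
          label (vertex (fun a => (v a : ℕ)) π j)).det) := by
    refine Finset.sum_congr rfl fun v _ => ?_
    simp_rw [det_labelMatrix_eq_sum _ fun j => h.le _ (vertex_le v _ _)]
    rw [Finset.sum_comm, Fin.sum_univ_succ, Fin.sum_univ_castSucc]
    have hmid := fun k : Fin n => sum_interior_facet label (fun a => (v a : ℕ)) k
    rw [Finset.sum_eq_zero fun k _ => hmid k, zero_add, Finset.sum_add_distrib]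
    congr 1
    · rw [← Equiv.sum_comp (Equiv.mulLeft (finRotate (n + 1)))]
      simp
    · simp
  have hσ : ∀ π : Equiv.Perm (Fin (n + 1)), π (π.symm (Fin.last n)) = Fin.last n := by simp
  rw [hfacets, Finset.sum_comm]
  simp_rw [fun π => sum_extreme_facets label h _ π (hσ π)]
  rw [← Equiv.sum_comp (Equiv.mulLeft (finRotate (n + 1))⁻¹),
    ← Equiv.sum_comp Equiv.Perm.decomposeFin.symm, Fintype.sum_prod_type,
    Finset.sum_eq_single (0 : Fin (n + 1)), fullCount,
    Finset.sum_comm (s := Finset.univ (α := Fin n → Fin (N + 1)))]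
  · refine Finset.sum_congr rfl fun σ _ => Finset.sum_congr rfl fun w _ => ?_
    rw [← det_top_facet label h]
    have : (Equiv.mulLeft (finRotate (n + 1))⁻¹ (Equiv.Perm.decomposeFin.symm (0, σ))).symm
        (Fin.last n) = 0 := by
      rw [Equiv.symm_apply_eq, Equiv.coe_mulLeft, Equiv.Perm.mul_apply, Equiv.Perm.eq_inv_iff_eq,
        finRotate_last]
      simp
    rw [this]
    rfl
  · intro p _ hp
    refine Finset.sum_eq_zero fun σ _ => Finset.sum_eq_zero fun w _ =>
      det_top_facet_eq_zero label h _ ?_ _ (hσ _) w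
    intro h0
    rw [Equiv.symm_apply_eq, Equiv.coe_mulLeft, Equiv.Perm.mul_apply, Equiv.Perm.eq_inv_iff_eq,
      finRotate_last] at h0
    exact hp (by simpa using h0.symm)
  · simp

/-- Kuhn's cubical Sperner lemma, counting modulo 2. -/
theorem fullCount_eq_one (n N : ℕ) (label : (Fin n → ℕ) → ℕ) (h : IsKuhnLabelling n N label) :
    fullCount n N label = 1 := by
  induction n with
  | zero =>
    have hl : ∀ x, label x = 0 := fun x => Nat.le_zero.mp (h.le x fun a => a.elim0)
    simp [fullCount, labelMatrix, hl]
  | succ n ih => rw [fullCount_succ label h, ih _ h.face]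

/-- Kuhn's cubical Sperner lemma: some small cube of the grid carries all labels. -/
theorem exists_fully_labelled_cube (n N : ℕ) (label : (Fin n → ℕ) → ℕ)
    (h : IsKuhnLabelling n N label) :
    ∃ v : Fin n → ℕ, ∀ l : Fin (n + 1), ∃ x : Fin n → ℕ,
      (∀ a, x a ≤ N + 1) ∧ (∀ a, v a ≤ x a ∧ x a ≤ v a + 1) ∧ label x = l := by
  have hne : fullCount n N label ≠ 0 := by
    rw [fullCount_eq_one n N label h]
    exact one_ne_zero
  obtain ⟨v, -, hv⟩ := Finset.exists_ne_zero_of_sum_ne_zero hne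
  obtain ⟨π, -, hπ⟩ := Finset.exists_ne_zero_of_sum_ne_zero hv
  refine ⟨fun a => (v a : ℕ), fun l => ?_⟩
  obtain ⟨j, hj⟩ := exists_label_of_det_ne_zero hπ l
  refine ⟨_, vertex_le v π j, fun a => ?_, hj⟩
  unfold vertex
  split_ifs <;> simp

end KuhnCube

section Covering

variable {n m : ℕ}

/-- The label of a piece is the largest `i + 1` such that it meets the face `x i = 1`, or `0`
if there is none. -/
noncomputable def pieceLabel (A : Fin m → Set (EuclideanSpace ℝ (Fin n))) (j : Fin m) : ℕ :=
  open Classical in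
  (Finset.univ.filter fun i : Fin n => ∃ y ∈ A j, y i = 1).sup fun i => (i : ℕ) + 1

theorem pieceLabel_le (A : Fin m → Set (EuclideanSpace ℝ (Fin n))) (j : Fin m) :
    pieceLabel A j ≤ n :=
  Finset.sup_le fun i _ => i.isLt

theorem lt_pieceLabel {A : Fin m → Set (EuclideanSpace ℝ (Fin n))} {j : Fin m}
    {y : EuclideanSpace ℝ (Fin n)} (hy : y ∈ A j) {i : Fin n} (hi : y i = 1) :
    (i : ℕ) < pieceLabel A j := by
  classical
  exact Finset.le_sup (f := fun i : Fin n => (i : ℕ) + 1)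
    (Finset.mem_filter.mpr ⟨Finset.mem_univ i, y, hy, hi⟩)

theorem exists_mem_of_pieceLabel_eq {A : Fin m → Set (EuclideanSpace ℝ (Fin n))} {j : Fin m}
    {i : Fin n} (h : pieceLabel A j = i + 1) : ∃ y ∈ A j, y i = 1 := by
  classical
  unfold pieceLabel at h
  rcases Finset.eq_empty_or_nonempty (Finset.univ.filter fun i : Fin n => ∃ y ∈ A j, y i = 1)
    with he | hne
  · rw [he] at h
    simp at h
  · obtain ⟨k, hk, hk'⟩ := Finset.exists_mem_eq_sup _ hne fun i : Fin n => (i : ℕ) + 1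
    have : k = i := Fin.ext (by simp only at hk'; omega)
    subst this
    exact (Finset.mem_filter.mp hk).2

theorem abs_apply_sub_le_dist (x y : EuclideanSpace ℝ (Fin n)) (i : Fin n) :
    |x i - y i| ≤ dist x y := by
  rw [dist_eq_norm]
  simpa using PiLp.norm_apply_le (x - y) i

theorem isCompact_cube (n : ℕ) :
    IsCompact {x : EuclideanSpace ℝ (Fin n) | ∀ i, x i ∈ Set.Icc (0 : ℝ) 1} := by
  have h := (isCompact_univ_pi fun _ : Fin n => isCompact_Icc (a := (0 : ℝ)) (b := 1)).image
    (PiLp.continuous_toLp 2 fun _ : Fin n => ℝ)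
  convert h using 1
  ext x
  constructor
  · intro hx
    exact ⟨x.ofLp, fun i _ => hx i, rfl⟩
  · rintro ⟨y, hy, rfl⟩ i
    exact hy i (Set.mem_univ i)

/-- At every scale, some small cube meets `n + 1` different pieces. -/
theorem exists_small_cube_meeting (N : ℕ) (A : Fin m → Set (EuclideanSpace ℝ (Fin n)))
    (hsub : ∀ j, A j ⊆ {x | ∀ i, x i ∈ Set.Icc (0 : ℝ) 1})
    (hcover : {x | ∀ i, x i ∈ Set.Icc (0 : ℝ) 1} ⊆ ⋃ j, A j)
    (hdiam : ∀ j, Metric.diam (A j) < 1) :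
    ∃ (c : Fin (n + 1) → Fin m) (p : Fin (n + 1) → EuclideanSpace ℝ (Fin n)),
      Function.Injective c ∧ (∀ l, p l ∈ A (c l)) ∧
      ∀ l l' i, |p l i - p l' i| ≤ 1 / ((N : ℝ) + 1) := by
  have hN : (0 : ℝ) < (N : ℝ) + 1 := by positivity
  let pt : (Fin n → ℕ) → EuclideanSpace ℝ (Fin n) :=
    fun x => WithLp.toLp 2 fun i => (x i : ℝ) / ((N : ℝ) + 1)
  have hpt : ∀ x i, pt x i = (x i : ℝ) / ((N : ℝ) + 1) := fun _ _ => rfl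
  have hmem : ∀ x : Fin n → ℕ, (∀ a, x a ≤ N + 1) → ∃ j, pt x ∈ A j := by
    intro x hx
    refine Set.mem_iUnion.mp (hcover fun i => ⟨?_, ?_⟩)
    · rw [hpt]
      positivity
    · rw [hpt, div_le_one hN]
      exact_mod_cast hx i
  obtain ⟨j₀, -⟩ := hmem (fun _ => 0) fun _ => Nat.zero_le _
  have hcol : ∀ x : Fin n → ℕ, ∃ j, (∀ a, x a ≤ N + 1) → pt x ∈ A j := by
    intro x
    by_cases hx : ∀ a, x a ≤ N + 1
    · obtain ⟨j, hj⟩ := hmem x hx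
      exact ⟨j, fun _ => hj⟩
    · exact ⟨j₀, fun h => absurd h hx⟩
  choose col hcol using hcol
  have hK : KuhnCube.IsKuhnLabelling n N fun x => pieceLabel A (col x) := by
    refine ⟨fun x _ => pieceLabel_le A _, fun x hx a ha => ?_, fun x hx a ha hl => ?_⟩
    · refine lt_pieceLabel (hcol x hx) ?_
      rw [hpt, ha]
      push_cast
      exact div_self hN.ne'
    · obtain ⟨y, hy, hy1⟩ := exists_mem_of_pieceLabel_eq hl
      have hbdd : Bornology.IsBounded (A (col x)) := (isCompact_cube n).isBounded.subset (hsub _)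
      have h1 := abs_apply_sub_le_dist y (pt x) a
      have h2 := Metric.dist_le_diam_of_mem hbdd hy (hcol x hx)
      rw [hy1, hpt, ha] at h1
      simp only [Nat.cast_zero, zero_div, sub_zero, abs_one] at h1
      linarith [hdiam (col x)]
  obtain ⟨v, hv⟩ := KuhnCube.exists_fully_labelled_cube n N _ hK
  choose x hx hxv hxl using hv
  refine ⟨fun l => col (x l), fun l => pt (x l), fun l l' h => ?_, fun l => hcol _ (hx l),
    fun l l' i => ?_⟩
  · have h' : col (x l) = col (x l') := h
    exact Fin.ext (by rw [← hxl l, ← hxl l', h'])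
  · rw [hpt, hpt, ← sub_div, abs_div, abs_of_pos hN]
    gcongr
    have h1 : (v i : ℝ) ≤ x l i := by exact_mod_cast (hxv l i).1
    have h2 : (x l i : ℝ) ≤ v i + 1 := by exact_mod_cast (hxv l i).2
    have h3 : (v i : ℝ) ≤ x l' i := by exact_mod_cast (hxv l' i).1
    have h4 : (x l' i : ℝ) ≤ v i + 1 := by exact_mod_cast (hxv l' i).2
    rw [abs_le]
    constructor <;> linarith

end Covering

/-- Lebesgue's covering theorem: the unit `n`-cube has no finite decomposition into
closed pieces of diameter `< 1` meeting at most `n` at a point. -/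
theorem lebesgue_covering_cube (n m : ℕ)
    (C : Set (EuclideanSpace ℝ (Fin n)))
    (hC : C = {x | ∀ i, x i ∈ Set.Icc (0:ℝ) 1})
    (A : Fin m → Set (EuclideanSpace ℝ (Fin n)))
    (hclosed : ∀ j, IsClosed (A j))
    (hsub : ∀ j, A j ⊆ C)
    (hcover : C ⊆ ⋃ j, A j)
    (hdiam : ∀ j, Metric.diam (A j) < 1) :
    ∃ x ∈ C, ∃ s : Finset (Fin m), n + 1 ≤ s.card ∧ ∀ j ∈ s, x ∈ A j := by
  subst hC
  choose c p hinj hp hclose using fun N => exists_small_cube_meeting N A hsub hcover hdiam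
  let U : Ultrafilter ℕ := Filter.hyperfilter ℕ
  have hU : (U : Filter ℕ) ≤ Filter.atTop := Nat.hyperfilter_le_atTop
  obtain ⟨c₀, hc₀⟩ := Ultrafilter.eq_pure_of_finite (U.map c)
  have hev : ∀ᶠ N in (U : Filter ℕ), c N = c₀ := by
    have : {c₀} ∈ U.map c := by
      rw [hc₀]
      exact Filter.mem_pure.mpr rfl
    exact this
  have hpC : ∀ N l, p N l ∈ {x : EuclideanSpace ℝ (Fin n) | ∀ i, x i ∈ Set.Icc (0 : ℝ) 1} :=
    fun N l => hsub _ (hp N l)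
  obtain ⟨x, hxC, hx⟩ := (isCompact_cube n).ultrafilter_le_nhds (U.map fun N => p N 0)
    (Filter.tendsto_principal.mpr (Filter.Eventually.of_forall fun N => hpC N 0))
  have hx0 : Filter.Tendsto (fun N => p N 0) U (nhds x) := hx
  have hlim : ∀ l, Filter.Tendsto (fun N => p N l) U (nhds x) := by
    intro l
    have hdiff : Filter.Tendsto (fun N => p N l - p N 0) U (nhds 0) := by
      rw [(PiLp.homeomorph 2 fun _ : Fin n => ℝ).isInducing.tendsto_nhds_iff, tendsto_pi_nhds]
      intro i
      refine squeeze_zero_norm (fun N => ?_)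
        ((tendsto_one_div_add_atTop_nhds_zero_nat (𝕜 := ℝ)).mono_left hU)
      exact hclose N l 0 i
    simpa using hdiff.add hx0
  have hmem : ∀ l, x ∈ A (c₀ l) := fun l =>
    (hclosed _).mem_of_tendsto (hlim l) (hev.mono fun N hN => hN ▸ hp N l)
  have hinj₀ : Function.Injective c₀ := by
    obtain ⟨N, hN⟩ := hev.exists
    exact hN ▸ hinj N
  refine ⟨x, hxC, Finset.univ.map ⟨c₀, hinj₀⟩, by simp, fun j hj => ?_⟩
  obtain ⟨l, -, rfl⟩ := Finset.mem_map.mp hj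
  exact hmem l
end

section
/- There is no finite decomposition of the closed unit ball $B^n=\{x\in\mathbb{R}^n:\|x\|\le 1\}$ into closed sets of diameter strictly less than $2/\sqrt{n}$ such that every point of $B^n$ lies in at most $n$ of the sets. -/
open Metric Set
open MeasureTheory Filter Topology
open scoped NNReal

section BoxDegree

variable {ι : Type*} [Fintype ι]

/-- A perturbation `x ↦ x + t • g x` of the identity that moves each point of the unit cube within
the faces containing it maps the open cube bijectively onto itself once `t` is small. -/
lemma injOn_and_image_add_smul_eq {g : (ι → ℝ) → ι → ℝ} {C : ℝ≥0}
    (hg : LipschitzOnWith C g (Icc 0 1))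
    (h0 : ∀ x ∈ Icc (0 : ι → ℝ) 1, ∀ i, x i = 0 → g x i = 0)
    (h1 : ∀ x ∈ Icc (0 : ι → ℝ) 1, ∀ i, x i = 1 → g x i = 0)
    (hmaps : ∀ x ∈ Icc (0 : ι → ℝ) 1, x + g x ∈ Icc (0 : ι → ℝ) 1)
    {t : ℝ≥0} (ht : t < 1) (htC : t * C < 1) :
    InjOn (fun x => x + (t : ℝ) • g x) (univ.pi fun _ => Ioo 0 1) ∧
      (fun x => x + (t : ℝ) • g x) '' (univ.pi fun _ => Ioo 0 1) = univ.pi fun _ => Ioo 0 1 := by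
  have hO : ∀ x : ι → ℝ, x ∈ (univ.pi fun _ => Ioo 0 1) → x ∈ Icc (0 : ι → ℝ) 1 :=
    fun x hx => ⟨fun i => (hx i trivial).1.le, fun i => (hx i trivial).2.le⟩
  have ht' : (t : ℝ) < 1 := ht
  refine ⟨fun x hx y hy hxy => ?_, Subset.antisymm ?_ ?_⟩
  · have hd := hg.dist_le_mul x (hO x hx) y (hO y hy)
    have hxy' : x - y = (t : ℝ) • (g y - g x) := by
      rw [smul_sub, sub_eq_sub_iff_add_eq_add, add_comm _ y]; exact hxy
    have hle : dist x y ≤ t * C * dist x y := by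
      calc dist x y = t * dist (g x) (g y) := by
            rw [dist_eq_norm, hxy', norm_smul, dist_comm, dist_eq_norm]; simp
        _ ≤ t * C * dist x y := by rw [mul_assoc]; gcongr
    have htC' : (t : ℝ) * C < 1 := by exact_mod_cast htC
    exact dist_le_zero.1 (by nlinarith [dist_nonneg (x := x) (y := y)])
  · rintro _ ⟨x, hx, rfl⟩ i -
    have hm := hmaps x (hO x hx)
    have ha := hm.1 i
    have hb := hm.2 i
    have hc := (hx i trivial).1
    have hd := (hx i trivial).2
    have ht0 : (0 : ℝ) ≤ t := t.2
    simp only [Pi.add_apply, Pi.zero_apply, Pi.one_apply, Pi.smul_apply, smul_eq_mul] at *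
    constructor <;> nlinarith
  · intro y hy
    let π : (ι → ℝ) → ι → ℝ := fun x i => projIcc (0 : ℝ) 1 zero_le_one (x i)
    have hπ : ∀ x, π x ∈ Icc (0 : ι → ℝ) 1 :=
      fun x => ⟨fun i => (projIcc (0 : ℝ) 1 zero_le_one (x i)).2.1,
        fun i => (projIcc (0 : ℝ) 1 zero_le_one (x i)).2.2⟩
    have hπL : LipschitzWith 1 π := by
      refine LipschitzWith.of_dist_le_mul fun a b => ?_
      rw [NNReal.coe_one, one_mul, dist_pi_le_iff dist_nonneg]
      intro i
      have h := (LipschitzWith.projIcc (zero_le_one (α := ℝ))).dist_le_mul (a i) (b i)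
      rw [NNReal.coe_one, one_mul] at h
      exact h.trans (dist_le_pi_dist a b i)
    have hcon : ContractingWith (t * C) (fun x => y - (t : ℝ) • g (π x)) := by
      refine ⟨htC, LipschitzWith.of_dist_le_mul fun a b => ?_⟩
      have hd := hg.dist_le_mul _ (hπ a) _ (hπ b)
      have hd' := hπL.dist_le_mul a b
      rw [NNReal.coe_one, one_mul] at hd'
      rw [dist_sub_left, dist_smul₀, NNReal.coe_mul, mul_assoc]
      simp only [NNReal.norm_eq]
      gcongr
      exact hd.trans (by gcongr)
    obtain ⟨x, hx⟩ : ∃ x, y - (t : ℝ) • g (π x) = x := ⟨_, hcon.fixedPoint_isFixedPt⟩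
    have hxi : ∀ i, y i - t * g (π x) i = x i := fun i => congrFun hx i
    have hxO : x ∈ (univ.pi fun _ => Ioo 0 1 : Set (ι → ℝ)) := by
      intro i _
      have hyi := hy i trivial
      have hi := hxi i
      constructor
      · by_contra! hle
        rw [h0 _ (hπ x) i (by simp [π, projIcc_of_le_left _ hle])] at hi
        linarith [hyi.1]
      · by_contra! hle
        rw [h1 _ (hπ x) i (by simp [π, projIcc_of_right_le _ hle])] at hi
        linarith [hyi.2]
    have hπx : π x = x := funext fun i => by
      simp [π, projIcc_of_mem zero_le_one (Ioo_subset_Icc_self (hxO i trivial))]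
    refine ⟨x, hxO, ?_⟩
    rw [hπx, sub_eq_iff_eq_add] at hx
    exact hx.symm

lemma volume_real_pi_Ioo_zero_one :
    volume.real (univ.pi fun _ => Ioo 0 1 : Set (ι → ℝ)) = 1 := by
  simp [Measure.real, Real.volume_pi_Ioo]

lemma eventually_integral_det_eq_one {g : (ι → ℝ) → ι → ℝ} (hg : ContDiff ℝ 1 g)
    (h0 : ∀ x ∈ Icc (0 : ι → ℝ) 1, ∀ i, x i = 0 → g x i = 0)
    (h1 : ∀ x ∈ Icc (0 : ι → ℝ) 1, ∀ i, x i = 1 → g x i = 0)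
    (hmaps : ∀ x ∈ Icc (0 : ι → ℝ) 1, x + g x ∈ Icc (0 : ι → ℝ) 1) :
    ∀ᶠ t : ℝ≥0 in 𝓝 0, ∫ x in (univ.pi fun _ => Ioo 0 1),
      (ContinuousLinearMap.id ℝ (ι → ℝ) + (t : ℝ) • fderiv ℝ g x).det = 1 := by
  obtain ⟨C, hC⟩ := hg.contDiffOn.exists_lipschitzOnWith one_ne_zero (convex_Icc (0 : ι → ℝ) 1)
    isCompact_Icc
  have hcont : Continuous fun p : ℝ≥0 × (ι → ℝ) =>
      (ContinuousLinearMap.id ℝ (ι → ℝ) + (p.1 : ℝ) • fderiv ℝ g p.2).det :=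
    ContinuousLinearMap.continuous_det.comp
      (continuous_const.add ((NNReal.continuous_coe.comp continuous_fst).smul
        ((hg.continuous_fderiv one_ne_zero).comp continuous_snd)))
  have hpos : ∀ᶠ t : ℝ≥0 in 𝓝 0, ∀ x ∈ Icc (0 : ι → ℝ) 1,
      0 < (ContinuousLinearMap.id ℝ (ι → ℝ) + (t : ℝ) • fderiv ℝ g x).det := by
    refine isCompact_Icc.eventually_forall_of_forall_eventually fun x _ => ?_
    refine hcont.continuousAt.eventually (lt_mem_nhds ?_)
    simp [ContinuousLinearMap.det]
  have ht1 : ∀ᶠ t : ℝ≥0 in 𝓝 0, t < 1 := gt_mem_nhds zero_lt_one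
  have htC : ∀ᶠ t : ℝ≥0 in 𝓝 0, t * C < 1 :=
    (continuous_id.mul continuous_const).continuousAt.eventually (gt_mem_nhds (by simp))
  filter_upwards [hpos, ht1, htC] with t hpos ht1 htC
  obtain ⟨hinj, himg⟩ := injOn_and_image_add_smul_eq hC h0 h1 hmaps ht1 htC
  have hO : MeasurableSet (univ.pi fun _ => Ioo 0 1 : Set (ι → ℝ)) :=
    MeasurableSet.univ_pi fun _ => measurableSet_Ioo
  have key := integral_image_eq_integral_abs_det_fderiv_smul volume hO
    (f' := fun x => ContinuousLinearMap.id ℝ (ι → ℝ) + (t : ℝ) • fderiv ℝ g x)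
    (fun x _ => ((hasFDerivAt_id x).add
      (((hg.differentiable one_ne_zero) x).hasFDerivAt.const_smul (t : ℝ))).hasFDerivWithinAt)
    hinj (fun _ => (1 : ℝ))
  replace himg : (id + (t : ℝ) • g) '' (univ.pi fun _ => Ioo 0 1) =
    univ.pi fun _ => Ioo 0 1 := himg
  rw [himg, setIntegral_const, volume_real_pi_Ioo_zero_one, one_smul] at key
  refine Eq.trans ?_ key.symm
  refine setIntegral_congr_fun hO fun x hx => ?_
  simp only [smul_eq_mul, mul_one]
  exact (abs_of_pos (hpos x
    ⟨fun i => (hx i trivial).1.le, fun i => (hx i trivial).2.le⟩)).symm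

/-- `t ↦ det (id + t • L)` is a polynomial of degree at most the dimension, hence determined by
its values at any `card ι + 1` points. -/
lemma det_id_add_eq_sum_lagrange (L : (ι → ℝ) →L[ℝ] ι → ℝ) {s : Finset ℝ}
    (hs : Fintype.card ι < s.card) :
    (ContinuousLinearMap.id ℝ (ι → ℝ) + L).det =
      ∑ t ∈ s, (ContinuousLinearMap.id ℝ (ι → ℝ) + t • L).det *
        (Lagrange.basis s id t).eval 1 := by
  classical
  let M := LinearMap.toMatrix' (L : (ι → ℝ) →ₗ[ℝ] ι → ℝ)
  let p : Polynomial ℝ := ((Polynomial.X : Polynomial ℝ) • M.map (Polynomial.C : ℝ →+* Polynomial ℝ) +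
    (1 : Matrix ι ι ℝ).map (Polynomial.C : ℝ →+* Polynomial ℝ)).det
  have hp : ∀ t : ℝ, p.eval t = (ContinuousLinearMap.id ℝ (ι → ℝ) + t • L).det := by
    intro t
    rw [ContinuousLinearMap.det, ← LinearMap.det_toMatrix', ← Polynomial.coe_evalRingHom,
      RingHom.map_det]
    congr 1
    ext i j
    rcases eq_or_ne i j with rfl | hij
    · simp [M, LinearMap.toMatrix'_apply, add_comm, mul_comm t]
    · simp [M, LinearMap.toMatrix'_apply, hij, mul_comm t]
  have hdeg : p.degree < s.card :=
    (Polynomial.degree_le_natDegree).trans_lt (by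
      exact_mod_cast (Polynomial.natDegree_det_X_add_C_le M 1).trans_lt hs)
  have hint := Lagrange.eq_interpolate (v := id) (Function.injective_id.injOn) hdeg
  have h1 := congrArg (Polynomial.eval 1) hint
  rw [hp, one_smul, Lagrange.interpolate_apply, Polynomial.eval_finsetSum] at h1
  simpa [hp] using h1

/-- The degree of a self-map of the cube preserving every face is `1`. -/
lemma integral_det_fderiv_eq_one {f : (ι → ℝ) → ι → ℝ} (hf : ContDiff ℝ 1 f)
    (h0 : ∀ x ∈ Icc (0 : ι → ℝ) 1, ∀ i, x i = 0 → f x i = 0)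
    (h1 : ∀ x ∈ Icc (0 : ι → ℝ) 1, ∀ i, x i = 1 → f x i = 1)
    (hmaps : MapsTo f (Icc 0 1) (Icc 0 1)) :
    ∫ x in (univ.pi fun _ => Ioo 0 1), (fderiv ℝ f x).det = 1 := by
  have hg : ContDiff ℝ 1 fun x => f x - x := hf.sub contDiff_id
  have hev := eventually_integral_det_eq_one hg
    (fun x hx i hi => by simp [h0 x hx i hi, hi]) (fun x hx i hi => by simp [h1 x hx i hi, hi])
    (fun x hx => by simpa using hmaps hx)
  obtain ⟨ε, hε, hball⟩ := (nhds_bot_basis (α := ℝ≥0)).eventually_iff.1 hev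
  obtain ⟨s, hsub, hcard⟩ := (Ioo_infinite hε).exists_subset_card_eq (Fintype.card ι + 1)
  let s' : Finset ℝ := s.map ⟨_, NNReal.coe_injective⟩
  have hcard' : s'.card = Fintype.card ι + 1 := by simp [s', hcard]
  have hs' : ∀ t ∈ s', ∫ x in (univ.pi fun _ => Ioo 0 1),
      (ContinuousLinearMap.id ℝ (ι → ℝ) + t • fderiv ℝ (fun x => f x - x) x).det = 1 := by
    intro t ht
    obtain ⟨u, hu, rfl⟩ := Finset.mem_map.1 ht
    exact hball (hsub hu).2
  have hint : ∀ t : ℝ, IntegrableOn (fun x =>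
      (ContinuousLinearMap.id ℝ (ι → ℝ) + t • fderiv ℝ (fun x => f x - x) x).det)
      (univ.pi fun _ => Ioo 0 1) := by
    intro t
    have hc : Continuous fun x =>
        (ContinuousLinearMap.id ℝ (ι → ℝ) + t • fderiv ℝ (fun x => f x - x) x).det :=
      ContinuousLinearMap.continuous_det.comp
        (continuous_const.add ((hg.continuous_fderiv one_ne_zero).const_smul t))
    exact (hc.continuousOn.integrableOn_compact (isCompact_Icc (a := (0 : ι → ℝ)) (b := 1))).mono_set
      fun x hx => ⟨fun i => (hx i trivial).1.le, fun i => (hx i trivial).2.le⟩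
  have hfd : ∀ x, fderiv ℝ f x =
      ContinuousLinearMap.id ℝ (ι → ℝ) + fderiv ℝ (fun x => f x - x) x := by
    intro x
    rw [fderiv_fun_sub ((hf.differentiable one_ne_zero) x) differentiableAt_fun_id, fderiv_fun_id]
    abel
  have hlt : Fintype.card ι < s'.card := by omega
  simp_rw [hfd, fun x => det_id_add_eq_sum_lagrange (fderiv ℝ (fun x => f x - x) x) hlt]
  rw [integral_finsetSum _ fun t _ => (hint t).mul_const _]
  simp_rw [integral_mul_const]
  rw [Finset.sum_congr rfl fun t ht => by rw [hs' t ht, one_mul], ← Polynomial.eval_finsetSum,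
    Lagrange.sum_basis Function.injective_id.injOn (Finset.card_pos.1 (by omega)),
    Polynomial.eval_one]

/-- A linear map whose range is spanned by fewer vectors than the dimension has determinant `0`. -/
lemma det_eq_zero_of_mem_span {L : (ι → ℝ) →L[ℝ] ι → ℝ} {T : Finset (ι → ℝ)}
    (hT : T.card < Fintype.card ι) (hL : ∀ w, L w ∈ Submodule.span ℝ (T : Set (ι → ℝ))) :
    L.det = 0 := by
  by_contra hdet
  have htop : (⊤ : Submodule ℝ (ι → ℝ)) ≤ Submodule.span ℝ (T : Set (ι → ℝ)) := by
    intro y _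
    obtain ⟨w, rfl⟩ := (LinearMap.equivOfDetNeZero (L : (ι → ℝ) →ₗ[ℝ] ι → ℝ) hdet).surjective y
    exact hL w
  have h1 := Submodule.finrank_mono htop
  have h2 := finrank_span_finset_le_card (R := ℝ) T
  rw [finrank_top, Module.finrank_fintype_fun_eq_card] at h1
  exact absurd (h1.trans h2) (by omega)

/-- **Lebesgue's covering theorem**: if finitely many closed sets cover the unit cube and none of
them meets two opposite faces, then some point of the cube lies in `card ι + 1` of them. -/
theorem exists_mem_of_closed_cover_cube {κ : Type*} [Fintype κ] {A : κ → Set (ι → ℝ)}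
    (hclosed : ∀ j, IsClosed (A j)) (hcover : Icc (0 : ι → ℝ) 1 ⊆ ⋃ j, A j)
    (hopp : ∀ j i, ∀ x ∈ A j ∩ Icc 0 1, ∀ y ∈ A j ∩ Icc 0 1, x i = 0 → y i ≠ 1) :
    ∃ x ∈ Icc (0 : ι → ℝ) 1, ∃ s : Finset κ, Fintype.card ι + 1 ≤ s.card ∧ ∀ j ∈ s, x ∈ A j := by
  classical
  by_contra! hno
  obtain ⟨δ, hδ, hleb⟩ := lebesgue_number_lemma_of_metric
    (c := fun y : Icc (0 : ι → ℝ) 1 => (⋃ j ∈ {j | (y : ι → ℝ) ∉ A j}, A j)ᶜ) isCompact_Icc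
    (fun y => ((toFinite _).isClosed_biUnion fun j _ => hclosed j).isOpen_compl)
    (fun y hy => mem_iUnion.2 ⟨⟨y, hy⟩, by simp⟩)
  let U : κ → Set (ι → ℝ) := fun j => thickening δ (A j ∩ Icc 0 1) ∩
    ⋂ i, {x | (∀ z ∈ A j ∩ Icc 0 1, z i ≠ 0) → x i ≠ 0} ∩
      {x | (∀ z ∈ A j ∩ Icc 0 1, z i ≠ 1) → x i ≠ 1}
  have hopen (P : Prop) (i : ι) (c : ℝ) : IsOpen {x : ι → ℝ | P → x i ≠ c} := by
    by_cases hP : P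
    · simpa [hP] using isOpen_ne_fun (continuous_apply i) continuous_const
    · simp [hP]
  have hU : ∀ j, IsOpen (U j) := fun j => isOpen_thickening.inter
    (isOpen_iInter_of_finite fun i => (hopen _ i 0).inter (hopen _ i 1))
  have hAU : Icc (0 : ι → ℝ) 1 ⊆ ⋃ j, U j := by
    intro x hx
    obtain ⟨j, hj⟩ := mem_iUnion.1 (hcover hx)
    refine mem_iUnion.2 ⟨j, self_subset_thickening hδ _ ⟨hj, hx⟩, mem_iInter.2 fun i => ?_⟩
    exact ⟨fun h => h x ⟨hj, hx⟩, fun h => h x ⟨hj, hx⟩⟩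
  have hUcard : ∀ x ∈ Icc (0 : ι → ℝ) 1, ∀ s : Finset κ, (∀ j ∈ s, x ∈ U j) →
      s.card ≤ Fintype.card ι := by
    intro x hx s hs
    obtain ⟨y, hy⟩ := hleb x hx
    by_contra! hcard
    obtain ⟨j, hj, hyj⟩ := hno y y.2 s hcard
    obtain ⟨z, hz, hxz⟩ := mem_thickening_iff.1 (hs j hj).1
    exact hy (mem_ball'.2 hxz) (mem_biUnion (show j ∈ {j | (y : ι → ℝ) ∉ A j} from hyj) hz.1)
  obtain ⟨φ, hφ⟩ := SmoothPartitionOfUnity.exists_isSubordinate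
    (modelWithCornersSelf ℝ (ι → ℝ)) (isClosed_Icc (a := (0 : ι → ℝ)) (b := 1)) U hU hAU
  have hsum : ∀ x ∈ Icc (0 : ι → ℝ) 1, ∑ j, φ j x = 1 := fun x hx => by
    rw [← finsum_eq_sum_of_fintype]; exact φ.sum_eq_one hx
  have hφU : ∀ j x, φ j x ≠ 0 → x ∈ U j := fun j x h => hφ j (subset_tsupport _ h)
  have hφs : ∀ j, ContDiff ℝ 1 (φ j) := fun j => (φ j).contMDiff.contDiff.of_le (by simp)
  let v : κ → ι → ℝ := fun j i => if ∃ z ∈ A j ∩ Icc 0 1, z i = 0 then 0 else 1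
  let f : (ι → ℝ) → ι → ℝ := fun x => ∑ j, φ j x • v j
  have hfi : ∀ x i, f x i = ∑ j, φ j x * v j i := fun x i => by simp [f]
  have hf : ContDiff ℝ 1 f := ContDiff.sum fun j _ => (hφs j).smul contDiff_const
  have hdeg : ∫ x in (univ.pi fun _ => Ioo 0 1), (fderiv ℝ f x).det = 1 := by
    refine integral_det_fderiv_eq_one hf (fun x hx i hi => ?_) (fun x hx i hi => ?_)
      fun x hx => ⟨fun i => ?_, fun i => ?_⟩
    · rw [hfi]
      refine Finset.sum_eq_zero fun j _ => ?_
      by_cases hj : φ j x = 0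
      · simp [hj]
      · have hx0 := (mem_iInter.1 (hφU j x hj).2 i).1
        have : ∃ z ∈ A j ∩ Icc 0 1, z i = 0 := by
          by_contra! h
          exact hx0 h hi
        simp only [v, if_pos this, mul_zero]
    · rw [hfi, ← hsum x hx]
      refine Finset.sum_congr rfl fun j _ => ?_
      by_cases hj : φ j x = 0
      · simp [hj]
      · have hx1 := (mem_iInter.1 (hφU j x hj).2 i).2
        have : ¬ ∃ z ∈ A j ∩ Icc 0 1, z i = 0 := by
          rintro ⟨z, hz, hz0⟩
          exact hx1 (fun w hw => hopp j i z hz w hw hz0) hi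
        simp only [v, if_neg this, mul_one]
    · rw [hfi]
      refine Finset.sum_nonneg fun j _ => mul_nonneg (φ.nonneg j x) ?_
      simp only [v]; split_ifs <;> simp
    · rw [hfi, Pi.one_apply, ← hsum x hx]
      refine Finset.sum_le_sum fun j _ => mul_le_of_le_one_right (φ.nonneg j x) ?_
      simp only [v]; split_ifs <;> simp
  have hzero : ∀ x ∈ (univ.pi fun _ => Ioo 0 1 : Set (ι → ℝ)), (fderiv ℝ f x).det = 0 := by
    intro x hx
    have hxI : x ∈ Icc (0 : ι → ℝ) 1 :=
      ⟨fun i => (hx i trivial).1.le, fun i => (hx i trivial).2.le⟩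
    have hφd : ∀ j, DifferentiableAt ℝ (φ j) x := fun j => (hφs j).differentiable one_ne_zero x
    let J : Finset κ := {j | x ∈ U j}
    have hJ : J.card ≤ Fintype.card ι := hUcard x hxI J fun j hj => by simpa [J] using hj
    obtain ⟨j₀, hj₀⟩ : J.Nonempty := by
      obtain ⟨j, hj⟩ := mem_iUnion.1 (hAU hxI)
      exact ⟨j, by simpa [J] using hj⟩
    have hd0 : ∀ j ∉ J, fderiv ℝ (φ j) x = 0 := by
      intro j hj
      have hx' : x ∉ tsupport (φ j) := fun h => hj (by simpa [J] using hφ j h)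
      have := (notMem_tsupport_iff_eventuallyEq.1 hx').fderiv_eq (𝕜 := ℝ)
      rw [this]
      exact fderiv_const_apply 0
    have hdsum : ∑ j, fderiv ℝ (φ j) x = 0 := by
      rw [← fderiv_fun_sum fun j _ => hφd j]
      have hev : (fun y => ∑ j, φ j y) =ᶠ[𝓝 x] fun _ => (1 : ℝ) := by
        filter_upwards [(isOpen_set_pi finite_univ fun _ _ => isOpen_Ioo).mem_nhds hx] with y hy
        exact hsum y ⟨fun i => (hy i trivial).1.le, fun i => (hy i trivial).2.le⟩
      rw [hev.fderiv_eq, fderiv_const_apply]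
    refine det_eq_zero_of_mem_span (T := (J.erase j₀).image fun j => v j - v j₀)
      (Finset.card_image_le.trans_lt (by
        have := Finset.card_erase_lt_of_mem hj₀
        omega)) fun w => ?_
    have hfw : fderiv ℝ f x w = ∑ j, fderiv ℝ (φ j) x w • (v j - v j₀) := by
      have h1 : fderiv ℝ f x w = ∑ j, fderiv ℝ (φ j) x w • v j := by
        simp only [f]
        rw [fderiv_fun_sum fun j _ => (hφd j).smul_const _, _root_.sum_apply]
        refine Finset.sum_congr rfl fun j _ => ?_
        rw [fderiv_smul_const (hφd j), ContinuousLinearMap.smulRight_apply]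
      have h2 : ∑ j, fderiv ℝ (φ j) x w = 0 := by
        rw [← _root_.sum_apply, hdsum, _root_.zero_apply]
      simp_rw [smul_sub, Finset.sum_sub_distrib, ← Finset.sum_smul, h2, zero_smul, sub_zero]
      exact h1
    rw [hfw]
    refine Submodule.sum_mem _ fun j _ => ?_
    by_cases hj : j ∈ J
    · by_cases hjj : j = j₀
      · simp [hjj]
      · refine Submodule.smul_mem _ _ (Submodule.subset_span ?_)
        exact Finset.mem_coe.2 (Finset.mem_image_of_mem (fun j => v j - v j₀)
          (Finset.mem_erase.2 ⟨hjj, hj⟩))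
    · simp [hd0 j hj]
  rw [setIntegral_congr_fun (MeasurableSet.univ_pi fun _ => measurableSet_Ioo) hzero] at hdeg
  simp at hdeg

end BoxDegree

/-- There is no finite decomposition of the closed unit ball in `ℝⁿ` into closed
sets of diameter `< 2/√n` meeting at most `n` at a point. -/
theorem lebesgue_covering_ball (n m : ℕ) (hn : 1 ≤ n)
    (A : Fin m → Set (EuclideanSpace ℝ (Fin n)))
    (hclosed : ∀ j, IsClosed (A j))
    (hsub : ∀ j, A j ⊆ Metric.closedBall (0 : EuclideanSpace ℝ (Fin n)) 1)
    (hcover : Metric.closedBall (0 : EuclideanSpace ℝ (Fin n)) 1 ⊆ ⋃ j, A j)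
    (hdiam : ∀ j, Metric.diam (A j) < 2 / Real.sqrt n) :
    ∃ x ∈ Metric.closedBall (0 : EuclideanSpace ℝ (Fin n)) 1,
      ∃ s : Finset (Fin m), n + 1 ≤ s.card ∧ ∀ j ∈ s, x ∈ A j := by
  have hn0 : (0 : ℝ) < n := by exact_mod_cast hn
  let e : (Fin n → ℝ) → EuclideanSpace ℝ (Fin n) :=
    fun x => WithLp.toLp 2 fun i => (2 * x i - 1) / √n
  have he : Continuous e := (PiLp.continuous_toLp 2 _).comp (by fun_prop)
  have hball : ∀ x ∈ Icc (0 : Fin n → ℝ) 1, e x ∈ closedBall (0 : EuclideanSpace ℝ (Fin n)) 1 := by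
    intro x hx
    rw [mem_closedBall_zero_iff, EuclideanSpace.norm_eq, Real.sqrt_le_one]
    calc ∑ i, ‖e x i‖ ^ 2 ≤ ∑ _i : Fin n, 1 / (n : ℝ) := by
          refine Finset.sum_le_sum fun i _ => ?_
          have h0 : 0 ≤ x i := hx.1 i
          have h1 : x i ≤ 1 := hx.2 i
          simp only [e, Real.norm_eq_abs, sq_abs, div_pow, Real.sq_sqrt hn0.le]
          gcongr
          nlinarith
      _ = 1 := by simp [hn0.ne']
  obtain ⟨x, hx, s, hs, hxs⟩ := exists_mem_of_closed_cover_cube (A := fun j => e ⁻¹' A j)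
    (fun j => (hclosed j).preimage he)
    (fun x hx => by simpa using hcover (hball x hx)) (by
      intro j i x hx y hy hx0 hy1
      have hd := dist_le_diam_of_mem (isBounded_closedBall.subset (hsub j)) hy.1 hx.1
      have hc := PiLp.norm_apply_le (e y - e x) i
      rw [← dist_eq_norm] at hc
      have hval : (e y - e x) i = 2 / √n := by
        simp only [PiLp.sub_apply, e, hx0, hy1]
        ring
      rw [hval, Real.norm_of_nonneg (by positivity)] at hc
      linarith [hdiam j])
  exact ⟨e x, hball x hx, s, by simpa using hs, hxs⟩
end

section
/- In any decomposition of the closed unit disk into finitely many closed connected sets meeting at most two at a point, where each piece's boundary consists of arcs of the unit circle and chords, some piece has diameter at least $\sqrt{3}$. Hence the inscribed equilateral triangle decomposition (with pieces of diameter exactly $\sqrt{3}$) is diameter-minimizing among such decompositions. -/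
open Metric Set

open scoped Topology

/-- A continuous planar map which points outwards along the unit circle has a zero in the disk. -/
theorem Complex.exists_eq_zero_of_re_conj_mul_pos {f : ℂ → ℂ} (hf : Continuous f)
    (hpos : ∀ x : ℂ, ‖x‖ = 1 → 0 < (starRingEnd ℂ x * f x).re) :
    ∃ x : ℂ, ‖x‖ ≤ 1 ∧ f x = 0 := by
  by_contra! hne
  let r : ℂ → ℂ := fun w ↦ ((max 1 ‖w‖)⁻¹ : ℝ) • w
  have hmax (w : ℂ) : 0 < max 1 ‖w‖ := lt_max_of_lt_left one_pos
  have hr : Continuous r :=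
    ((continuous_const.max continuous_norm).inv₀ fun w ↦ (hmax w).ne').smul continuous_id
  have hr_norm (w : ℂ) : ‖r w‖ ≤ 1 := by
    rw [norm_smul, norm_inv, Real.norm_of_nonneg (hmax w).le, inv_mul_le_one₀ (hmax w)]
    exact le_max_right _ _
  have hr_circle (w : ℂ) (hw : ‖w‖ = 1) : r w = w := by simp [r, hw]
  let F : C(ℂ, ℂ) := ⟨fun w ↦ f (r w), hf.comp hr⟩
  have hF (w : ℂ) : F w ≠ 0 := hne _ (hr_norm w)
  obtain ⟨g, ⟨-, hg⟩, -⟩ := isCoveringMapOn_exp.existsUnique_continuousMap_lifts F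
    (a₀ := 0) (e₀ := Complex.log (F 0)) (Complex.exp_log (hF 0)) hF
  let e : ℝ → ℂ := fun θ ↦ Complex.exp (θ * Complex.I)
  have he_cont : Continuous e := by fun_prop
  have he_norm (θ : ℝ) : ‖e θ‖ = 1 := Complex.norm_exp_ofReal_mul_I θ
  have hg_exp (θ : ℝ) : Complex.exp (g (e θ)) = f (e θ) := by
    rw [show Complex.exp (g (e θ)) = F (e θ) from congrFun hg (e θ)]
    exact congrArg f (hr_circle _ (he_norm θ))
  let q : ℝ → ℂ := fun θ ↦ starRingEnd ℂ (e θ) * f (e θ)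
  have hq_slit (θ : ℝ) : q θ ∈ Complex.slitPlane := Or.inl (hpos _ (he_norm θ))
  have hq_cont : Continuous q := (Complex.continuous_conj.comp he_cont).mul (hf.comp he_cont)
  let k : ℝ → ℂ := fun θ ↦ g (e θ) - θ * Complex.I - Complex.log (q θ)
  have hk_cont : Continuous k :=
    ((g.continuous.comp he_cont).sub (by fun_prop)).sub (hq_cont.clog hq_slit)
  have hk_exp (θ : ℝ) : Complex.exp (k θ) = 1 := by
    have hq0 := Complex.slitPlane_ne_zero (hq_slit θ)
    have h1 : Complex.exp (k θ) = f (e θ) / e θ / q θ := by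
      simp only [k, Complex.exp_sub, hg_exp, Complex.exp_log hq0, e]
    have h2 : e θ * starRingEnd ℂ (e θ) = 1 := by
      rw [Complex.mul_conj, Complex.normSq_eq_norm_sq, he_norm]; norm_num
    have h3 : e θ * q θ = f (e θ) := by simp only [q]; rw [← mul_assoc, h2, one_mul]
    rw [h1, ← h3, mul_div_cancel_left₀ _ (Complex.exp_ne_zero _), div_self hq0]
  have hk_const : k = fun _ ↦ k 0 :=
    Complex.isCoveringMap_exp.eq_of_comp_eq hk_cont continuous_const
      (funext fun θ ↦ Subtype.ext ((hk_exp θ).trans (hk_exp 0).symm)) 0 rfl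
  have h2π : k (2 * Real.pi) = k 0 := congrFun hk_const _
  have he2π : e (2 * Real.pi) = e 0 := by simp [e]
  simp only [k, q, he2π] at h2π
  simp [Real.pi_ne_zero] at h2π

/-- Compact-disk version of `Complex.exists_eq_zero_of_re_conj_mul_pos` on the Euclidean plane. -/
theorem EuclideanSpace.exists_eq_zero_of_inner_pos
    {f : EuclideanSpace ℝ (Fin 2) → EuclideanSpace ℝ (Fin 2)} (hf : Continuous f)
    (hpos : ∀ x, ‖x‖ = 1 → 0 < inner ℝ x (f x)) :
    ∃ x, ‖x‖ ≤ 1 ∧ f x = 0 := by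
  let L : ℂ ≃ₗᵢ[ℝ] EuclideanSpace ℝ (Fin 2) := Complex.orthonormalBasisOneI.repr
  obtain ⟨x, hx, hx0⟩ := Complex.exists_eq_zero_of_re_conj_mul_pos
    (f := fun w ↦ L.symm (f (L w))) (by fun_prop) fun w hw ↦ by
      have h := hpos (L w) (by rwa [L.norm_map])
      rw [← L.apply_symm_apply (f (L w)), L.inner_map_map, Complex.inner, mul_comm] at h
      simpa [mul_comm] using h
  exact ⟨L x, by rwa [L.norm_map], by simpa using hx0⟩

theorem norm_ge_of_mem_convexHull_of_inner_ge {E : Type*} [NormedAddCommGroup E]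
    [InnerProductSpace ℝ E] [FiniteDimensional ℝ E] (hE : Module.finrank ℝ E = 2) {K : Set E}
    {t : ℝ} (ht : t ≤ 1) (hK1 : ∀ x ∈ K, ‖x‖ = 1) (hK : ∀ x ∈ K, ∀ y ∈ K, t ≤ inner ℝ x y)
    {x : E} (hx : x ∈ convexHull ℝ K) : (1 + 2 * t) / 3 ≤ ‖x‖ := by
  obtain ⟨ι, _, y, w, hyK, hy, hw, hw1, rfl⟩ := eq_pos_convex_span_of_mem_convexHull hx
  have hyK' (i : ι) : y i ∈ K := hyK (Set.mem_range_self i)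
  have hcard : (Fintype.card ι : ℝ) ≤ 3 := by
    have h1 := hy.card_le_finrank_succ
    have h2 := Submodule.finrank_le (vectorSpan ℝ (Set.range y))
    exact_mod_cast (by omega : Fintype.card ι ≤ 3)
  obtain ⟨i, hi⟩ : ∃ i, 1 / 3 ≤ w i := by
    by_contra! h
    have hne : (Finset.univ : Finset ι).Nonempty := by
      by_contra hne
      rw [Finset.not_nonempty_iff_eq_empty] at hne
      simp [hne] at hw1
    have := Finset.sum_lt_sum_of_nonempty hne fun i _ ↦ h i
    simp [hw1] at this
    linarith
  have hsum : w i * (1 - t) ≤ ∑ j, w j * (inner ℝ (y i) (y j) - t) := by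
    have hii : inner ℝ (y i) (y i) = (1 : ℝ) := by
      rw [real_inner_self_eq_norm_sq, hK1 _ (hyK' i), one_pow]
    have := Finset.single_le_sum (f := fun j ↦ w j * (inner ℝ (y i) (y j) - t))
      (fun j _ ↦ mul_nonneg (hw j).le (sub_nonneg.2 (hK _ (hyK' i) _ (hyK' j))))
      (Finset.mem_univ i)
    simpa only [hii] using this
  have heq : inner ℝ (y i) (∑ j, w j • y j) = ∑ j, w j * (inner ℝ (y i) (y j) - t) + t := by
    simp only [inner_sum, real_inner_smul_right, mul_sub, Finset.sum_sub_distrib,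
      ← Finset.sum_mul, hw1]
    ring
  have hle := real_inner_le_norm (y i) (∑ j, w j • y j)
  rw [hK1 _ (hyK' i), one_mul, heq] at hle
  nlinarith

theorem exists_one_lt_inner_of_diam_lt_sqrt_three {E : Type*} [NormedAddCommGroup E]
    [InnerProductSpace ℝ E] [FiniteDimensional ℝ E] (hE : Module.finrank ℝ E = 2) {K : Set E}
    (hKb : Bornology.IsBounded K) (hdiam : Metric.diam K < Real.sqrt 3) :
    ∃ c : E, ∀ x ∈ K, ‖x‖ = 1 → 1 < inner ℝ x c := by
  set t : ℝ := 1 - Metric.diam K ^ 2 / 2 with ht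
  have hd : 0 ≤ Metric.diam K := Metric.diam_nonneg
  have hd3 : Metric.diam K ^ 2 < 3 := (Real.lt_sqrt hd).1 hdiam
  have hinner : ∀ x ∈ K ∩ sphere 0 1, ∀ y ∈ K ∩ sphere 0 1, t ≤ inner ℝ x y := by
    rintro x ⟨hxK, hx⟩ y ⟨hyK, hy⟩
    have h1 := norm_sub_sq_real x y
    have h2 : ‖x - y‖ ≤ Metric.diam K := dist_eq_norm x y ▸ Metric.dist_le_diam_of_mem hKb hxK hyK
    rw [mem_sphere_zero_iff_norm.1 hx, mem_sphere_zero_iff_norm.1 hy] at h1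
    nlinarith [norm_nonneg (x - y)]
  have hhull : closure (convexHull ℝ (K ∩ sphere 0 1)) ⊆ {x | (1 + 2 * t) / 3 ≤ ‖x‖} :=
    closure_minimal (fun x hx ↦ norm_ge_of_mem_convexHull_of_inner_ge hE (by nlinarith)
      (fun x hx ↦ mem_sphere_zero_iff_norm.1 hx.2) hinner hx)
      (isClosed_le continuous_const continuous_norm)
  have h0 : (0 : E) ∉ closure (convexHull ℝ (K ∩ sphere 0 1)) := fun h ↦ by
    have := hhull h
    simp only [Set.mem_ofPred_eq, norm_zero] at this
    linarith
  obtain ⟨φ, u, hu0, hu⟩ := geometric_hahn_banach_point_closed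
    (convex_convexHull ℝ _).closure isClosed_closure h0
  rw [map_zero] at hu0
  refine ⟨u⁻¹ • (InnerProductSpace.toDual ℝ E).symm φ, fun x hx hx1 ↦ ?_⟩
  have hux := hu x (subset_closure (subset_convexHull ℝ _ ⟨hx, mem_sphere_zero_iff_norm.2 hx1⟩))
  rwa [real_inner_smul_right, real_inner_comm, InnerProductSpace.toDual_symm_apply,
    inv_mul_eq_div, one_lt_div hu0]

theorem IsCompact.eventually_forall_lt {X : Type*} [TopologicalSpace X] {K : Set X}
    (hK : IsCompact K) {g : X → ℝ} (hg : Continuous g) (hpos : ∀ x ∈ K, 0 < g x) :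
    ∀ᶠ δ in 𝓝[>] (0 : ℝ), ∀ x ∈ K, δ < g x := by
  obtain rfl | hne := K.eq_empty_or_nonempty
  · simp
  obtain ⟨x₀, hx₀, hmin⟩ := hK.exists_isMinOn hne hg.continuousOn
  filter_upwards [Ioo_mem_nhdsGT (hpos x₀ hx₀)] with δ hδ x hx
  exact hδ.2.trans_le (hmin hx)

theorem exists_norm_lt_forall_notMem_segment {E ι : Type*} [NormedAddCommGroup E]
    [NormedSpace ℝ E] [FiniteDimensional ℝ E] (hE : 1 < Module.finrank ℝ E) [Countable ι]
    (c : ι → E) {r : ℝ} (hr : 0 < r) :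
    ∃ z : E, ‖z‖ < r ∧ ∀ i j, z ∉ segment ℝ (c i) (c j) := by
  borelize E
  let μ : MeasureTheory.Measure E := MeasureTheory.Measure.addHaar
  have hnull (i j : ι) : μ (segment ℝ (c i) (c j)) = 0 := by
    refine MeasureTheory.measure_mono_null (t := line[ℝ, c i, c j]) ?_
      (MeasureTheory.Measure.addHaar_affineSubspace μ _ fun htop ↦ ?_)
    · rw [← convexHull_pair]
      exact convexHull_subset_affineSpan _
    · have h := collinear_iff_finrank_le_one.1 (collinear_pair ℝ (c i) (c j))
      rw [← direction_affineSpan, htop, AffineSubspace.direction_top, finrank_top] at h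
      omega
  have hU : μ (⋃ (i) (j), segment ℝ (c i) (c j)) = 0 := by
    simp only [MeasureTheory.measure_iUnion_null_iff]
    exact hnull
  have hball : μ (ball 0 r) ≠ 0 := (measure_ball_pos μ 0 hr).ne'
  obtain ⟨z, hz, hzU⟩ : (ball (0 : E) r \ ⋃ (i) (j), segment ℝ (c i) (c j)).Nonempty := by
    by_contra h
    rw [Set.not_nonempty_iff_eq_empty, Set.sdiff_eq_empty] at h
    exact hball (MeasureTheory.measure_mono_null h hU)
  exact ⟨z, mem_ball_zero_iff.1 hz, by simpa using hzU⟩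

theorem mem_segment_of_add_smul_sub_eq_zero {E : Type*} [AddCommGroup E] [Module ℝ E]
    {a b z : E} {s t : ℝ} (hs : 0 < s) (ht : 0 < t) (h : s • (a - z) + t • (b - z) = 0) :
    z ∈ segment ℝ a b := by
  have hst : s + t ≠ 0 := (add_pos hs ht).ne'
  refine ⟨s / (s + t), t / (s + t), by positivity, by positivity, by field_simp, ?_⟩
  have h' : s • a + t • b = (s + t) • z := by
    rw [← sub_eq_zero, ← h]; module
  rw [div_eq_inv_mul, div_eq_inv_mul, mul_smul, mul_smul, ← smul_add, h', inv_smul_smul₀ hst]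

/-- A sum of at most two vectors `c j - z` with positive coefficients is nonzero if `z` lies on
no segment joining two of the points `c j`. -/
theorem sum_smul_sub_ne_zero {E ι : Type*} [AddCommGroup E] [Module ℝ E] [Fintype ι]
    {c : ι → E} {z : E} (hz : ∀ i j, z ∉ segment ℝ (c i) (c j)) {φ : ι → ℝ} {s : Finset ι}
    (hs : ∀ j ∈ s, 0 < φ j) (hs' : ∀ j ∉ s, φ j = 0) (hne : s.Nonempty) (hcard : s.card ≤ 2) :
    ∑ j, φ j • (c j - z) ≠ 0 := by
  classical
  rw [← Finset.sum_subset (Finset.subset_univ s) fun j _ hj ↦ by rw [hs' j hj, zero_smul]]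
  have hpos := hne.card_pos
  intro h
  obtain h1 | h2 : s.card = 1 ∨ s.card = 2 := by omega
  · obtain ⟨i, rfl⟩ := Finset.card_eq_one.1 h1
    have hi := hs i (by simp)
    rw [Finset.sum_singleton] at h
    exact hz i i (mem_segment_of_add_smul_sub_eq_zero hi hi (by rw [h, add_zero]))
  · obtain ⟨i, j, hij, rfl⟩ := Finset.card_eq_two.1 h2
    rw [Finset.sum_pair hij] at h
    exact hz i j (mem_segment_of_add_smul_sub_eq_zero (hs i (by simp)) (hs j (by simp)) h)

/-- In any finite decomposition of the closed unit disk into closed connected sets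
meeting at most two at a point, whose boundaries consist of arcs of the unit circle
and chords, some piece has diameter at least `√3`.  Hence the inscribed equilateral
triangle decomposition is diameter-minimizing among such decompositions. -/
theorem disk_decomposition_diam_ge_sqrt_three (m : ℕ)
    (A : Fin m → Set (EuclideanSpace ℝ (Fin 2)))
    (hclosed : ∀ j, IsClosed (A j))
    (hconn : ∀ j, IsConnected (A j))
    (hsub : ∀ j, A j ⊆ Metric.closedBall (0 : EuclideanSpace ℝ (Fin 2)) 1)
    (hcover : (⋃ j, A j) = Metric.closedBall (0 : EuclideanSpace ℝ (Fin 2)) 1)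
    (hdisjint : Pairwise fun i j => Disjoint (interior (A i)) (interior (A j)))
    (hmeet : ∀ x : EuclideanSpace ℝ (Fin 2),
      ∀ s : Finset (Fin m), (∀ j ∈ s, x ∈ A j) → s.card ≤ 2)
    (hbdry : ∀ j, ∃ (k : ℕ) (p q : Fin k → EuclideanSpace ℝ (Fin 2)),
      (∀ l, ‖p l‖ = 1 ∧ ‖q l‖ = 1) ∧
      frontier (A j) ⊆
        Metric.sphere (0 : EuclideanSpace ℝ (Fin 2)) 1 ∪ ⋃ l, segment ℝ (p l) (q l)) :
    ∃ j, Real.sqrt 3 ≤ Metric.diam (A j) := by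
  classical
  by_contra! hdiam
  have hE : Module.finrank ℝ (EuclideanSpace ℝ (Fin 2)) = 2 := by simp
  choose c hc using fun j ↦ exists_one_lt_inner_of_diam_lt_sqrt_three hE
    (isBounded_closedBall.subset (hsub j)) (hdiam j)
  have hmem (j : Fin m) {x : EuclideanSpace ℝ (Fin 2)} (h : infDist x (A j) ≤ 0) : x ∈ A j :=
    ((hclosed j).mem_iff_infDist_zero (hconn j).nonempty).2 (h.antisymm infDist_nonneg)
  have htriple : ∀ᶠ δ in 𝓝[>] (0 : ℝ), ∀ i j k, i ≠ j → i ≠ k → j ≠ k →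
      ∀ x ∈ closedBall (0 : EuclideanSpace ℝ (Fin 2)) 1,
        δ < (infDist x (A i) + infDist x (A j) + infDist x (A k)) / 3 := by
    simp only [Filter.eventually_all]
    intro i j k hij hik hjk
    refine (isCompact_closedBall _ _).eventually_forall_lt
      ((((continuous_infDist_pt _).add (continuous_infDist_pt _)).add
        (continuous_infDist_pt _)).div_const _) fun x _ ↦ ?_
    by_contra! hx
    have hi := infDist_nonneg (x := x) (s := A i)
    have hj := infDist_nonneg (x := x) (s := A j)
    have hk := infDist_nonneg (x := x) (s := A k)
    have h := hmeet x {i, j, k} fun l hl ↦ by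
      simp only [Finset.mem_insert, Finset.mem_singleton] at hl
      rcases hl with rfl | rfl | rfl <;> exact hmem _ (by linarith)
    rw [Finset.card_eq_three.2 ⟨i, j, k, hij, hik, hjk, rfl⟩] at h
    omega
  have hcircle : ∀ᶠ δ in 𝓝[>] (0 : ℝ), ∀ j,
      ∀ x ∈ sphere (0 : EuclideanSpace ℝ (Fin 2)) 1 ∩ {x | inner ℝ x (c j) ≤ 1 / 2},
        δ < infDist x (A j) := by
    simp only [Filter.eventually_all]
    intro j
    refine ((isCompact_sphere _ _).inter_right (isClosed_le (by fun_prop)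
      continuous_const)).eventually_forall_lt (continuous_infDist_pt _) ?_
    rintro x ⟨hx, hxc⟩
    by_contra! h
    have := hc j x (hmem j h) (mem_sphere_zero_iff_norm.1 hx)
    simp only [Set.mem_ofPred_eq] at hxc
    linarith
  obtain ⟨δ, ⟨htriple, hcircle⟩, hδ⟩ :=
    ((htriple.and hcircle).and (self_mem_nhdsWithin (a := (0 : ℝ)) (s := Ioi 0))).exists
  obtain ⟨z, hz, hzseg⟩ := exists_norm_lt_forall_notMem_segment (by omega) c
    (one_half_pos : (0 : ℝ) < 1 / 2)
  let φ : Fin m → EuclideanSpace ℝ (Fin 2) → ℝ := fun j x ↦ max 0 (δ - infDist x (A j))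
  have hφ_nonneg (j x) : 0 ≤ φ j x := le_max_left _ _
  have hφ_pos {j x} : 0 < φ j x ↔ infDist x (A j) < δ := by simp [φ]
  have hφ_cont (j) : Continuous (φ j) :=
    continuous_const.max (continuous_const.sub (continuous_infDist_pt _))
  have hex {x} (hx : ‖x‖ ≤ 1) : ∃ j, 0 < φ j x := by
    rw [← mem_closedBall_zero_iff, ← hcover] at hx
    obtain ⟨j, hj⟩ := Set.mem_iUnion.1 hx
    exact ⟨j, hφ_pos.2 (by rwa [infDist_zero_of_mem hj])⟩
  obtain ⟨x, hx, hx0⟩ := EuclideanSpace.exists_eq_zero_of_inner_pos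
    (f := fun x ↦ ∑ j, φ j x • (c j - z))
    (continuous_finsetSum _ fun j _ ↦ (hφ_cont j).smul continuous_const) fun x hx ↦ by
      have hin (j) (hj : 0 < φ j x) : 0 < inner ℝ x (c j - z) := by
        have h1 : 1 / 2 < inner ℝ x (c j) := by
          by_contra! h
          exact (hφ_pos.1 hj).not_gt (hcircle j x ⟨mem_sphere_zero_iff_norm.2 hx, h⟩)
        have h2 := real_inner_le_norm x z
        rw [hx, one_mul] at h2
        rw [inner_sub_right]
        linarith
      simp only [inner_sum, real_inner_smul_right]
      obtain ⟨j, hj⟩ := hex hx.le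
      refine Finset.sum_pos' (fun i _ ↦ ?_) ⟨j, Finset.mem_univ j, mul_pos hj (hin j hj)⟩
      obtain h | h := (hφ_nonneg i x).eq_or_lt
      · rw [← h, zero_mul]
      · exact (mul_pos h (hin i h)).le
  obtain ⟨j, hj⟩ := hex hx
  refine sum_smul_sub_ne_zero (s := {j | 0 < φ j x}) hzseg (fun j hj ↦ by simpa using hj)
    (fun j hj ↦ le_antisymm (by simpa using hj) (hφ_nonneg j x)) ⟨j, by simpa using hj⟩ ?_ hx0
  by_contra! h
  obtain ⟨i, hi, j, hj, k, hk, hij, hik, hjk⟩ := Finset.two_lt_card.1 h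
  simp only [Finset.mem_filter, Finset.mem_univ, true_and, hφ_pos] at hi hj hk
  linarith [htriple i j k hij hik hjk x (mem_closedBall_zero_iff.2 hx)]
end
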